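/- arXiv:1909.01151 — 2 statements merged into one kernel-verified Lean document; each statement's English description precedes it below -/
import Mathlib

section
/- For every r ∈ (0, 1/2) there exist a > 0, a continuous nonincreasing driving function λ : [0,1] → ℝ with λ(1) = 0 and λ(t) ≥ a(1−t)^r for all t ∈ [0,1], and a continuous injective curve γ : [0,1) → ℂ with γ(0) = λ(0) and Im γ(t) > 0 for t > 0, such that the Loewner hulls driven by λ satisfy K_t = γ([0,t]) for every t ∈ [0,1), but lim_{t→1} γ(t) does not exist; indeed the set of subsequential limits of γ(t) as t → 1 contains a nondegenerate interval of the real line. -/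
open Set Complex Filter

noncomputable section

/-- A point `z` in the closed upper half-plane *survives* to time `t` under the
continuous real driving function `lam` if the chordal Loewner ODE
`g'(s) = 2 / (g s - lam s)`, `g 0 = z`, has a solution on `[0, t]` whose
denominator never vanishes. -/
def Survives (lam : ℝ → ℝ) (t : ℝ) (z : ℂ) : Prop :=
  ∃ g : ℝ → ℂ, g 0 = z ∧ ContinuousOn g (Icc 0 t) ∧
    ∀ s ∈ Icc (0:ℝ) t, g s ≠ (lam s : ℂ) ∧
      HasDerivWithinAt g (2 / (g s - (lam s : ℂ))) (Icc 0 t) s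

/-- The Loewner hull at time `t` driven by `lam`. -/
def LoewnerHull (lam : ℝ → ℝ) (t : ℝ) : Set ℂ :=
  { z : ℂ | 0 ≤ z.im ∧ ¬ Survives lam t z }

/-- `γ : [0,T) → ℂ` is the simple trace driven by `lam`. -/
def IsSimpleTrace (lam : ℝ → ℝ) (T : ℝ) (γ : ℝ → ℂ) : Prop :=
  ContinuousOn γ (Ico 0 T) ∧ InjOn γ (Ico 0 T) ∧ γ 0 = ((lam 0 : ℝ) : ℂ) ∧
    (∀ t ∈ Ioo (0:ℝ) T, 0 < (γ t).im) ∧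
    ∀ t ∈ Ico (0:ℝ) T, LoewnerHull lam t = γ '' Icc 0 t

/-! ### One-sided derivative criteria, read backwards in time -/

lemma le_of_deriv_left_nonneg {f f' : ℝ → ℝ} {a b : ℝ} (hab : a ≤ b)
    (hf : ContinuousOn f (Icc a b)) (hd : ∀ x ∈ Ioc a b, HasDerivWithinAt f (f' x) (Iic x) x)
    (hn : ∀ x ∈ Ioc a b, 0 ≤ f' x) : f a ≤ f b := by
  have key := image_le_of_deriv_right_le_deriv_boundary (f := fun s => f (-s))
    (f' := fun s => -f' (-s)) (a := -b) (b := -a) (B := fun _ => f b) (B' := fun _ => 0)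
    (hf.comp continuous_neg.continuousOn fun s hs => ⟨by linarith [hs.2], by linarith [hs.1]⟩)
    ?_ (by simp) continuousOn_const (fun x _ => hasDerivWithinAt_const _ _ _) ?_
    (x := -a) ⟨by linarith, le_rfl⟩
  · simpa using key
  · intro x hx
    have := (hd (-x) ⟨by linarith [hx.2], by linarith [hx.1]⟩).scomp x
      (hasDerivAt_neg x).hasDerivWithinAt (s := Ici x)
      (fun y hy => by simp only [mem_Iic, mem_Ici] at *; linarith)
    simpa using! this
  · intro x hx
    have := hn (-x) ⟨by linarith [hx.2], by linarith [hx.1]⟩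
    simpa using this

lemma fence_left {f f' B B' : ℝ → ℝ} {a b : ℝ} (hab : a ≤ b)
    (hf : ContinuousOn f (Icc a b)) (hd : ∀ x ∈ Ioc a b, HasDerivWithinAt f (f' x) (Iic x) x)
    (hB : ∀ x, HasDerivAt B (B' x) x) (hb : f b ≤ B b)
    (hlt : ∀ x ∈ Ioc a b, f x = B x → B' x < f' x) : f a ≤ B a := by
  have key := image_le_of_deriv_right_lt_deriv_boundary (f := fun s => f (-s))
    (f' := fun s => -f' (-s)) (a := -b) (b := -a) (B := fun s => B (-s)) (B' := fun s => -B' (-s))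
    (hf.comp continuous_neg.continuousOn fun s hs => ⟨by linarith [hs.2], by linarith [hs.1]⟩)
    ?_ (by simpa using hb) ?_ ?_
    (x := -a) ⟨by linarith, le_rfl⟩
  · simpa using key
  · intro x hx
    have := (hd (-x) ⟨by linarith [hx.2], by linarith [hx.1]⟩).scomp x
      (hasDerivAt_neg x).hasDerivWithinAt (s := Ici x)
      (fun y hy => by simp only [mem_Iic, mem_Ici] at *; linarith)
    simpa using! this
  · intro x
    have := (hB (-x)).scomp x (hasDerivAt_neg x)
    simpa using! this
  · intro x hx h
    have := hlt (-x) ⟨by linarith [hx.2], by linarith [hx.1]⟩ h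
    linarith

lemma norm_le_exp_of_deriv_le {δ δ' : ℝ → ℂ} {T K : ℝ} (hK : 0 ≤ K)
    (hd : ∀ s ∈ Icc 0 T, HasDerivWithinAt δ (δ' s) (Icc 0 T) s)
    (hb : ∀ s ∈ Icc 0 T, ‖δ' s‖ ≤ K * ‖δ s‖) {a s : ℝ} (ha : a ∈ Icc 0 T) (hs : s ∈ Icc 0 T) :
    ‖δ s‖ ≤ ‖δ a‖ * Real.exp (K * T) := by
  have hc : ContinuousOn δ (Icc 0 T) := fun s hs => (hd s hs).continuousWithinAt
  have hexp : ∀ r, r ≤ T → ‖δ a‖ * Real.exp (K * r) ≤ ‖δ a‖ * Real.exp (K * T) := fun r hr => by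
    gcongr
  rcases le_total a s with h | h
  · have := norm_le_gronwallBound_of_norm_deriv_right_le (f := δ) (f' := δ') (δ := ‖δ a‖) (K := K)
      (ε := 0) (a := a) (b := T) (hc.mono (Icc_subset_Icc_left ha.1))
      (fun x hx => (hd x ⟨ha.1.trans hx.1, hx.2.le⟩).mono_of_mem_nhdsWithin
        (Icc_mem_nhdsGE_of_mem ⟨ha.1.trans hx.1, hx.2⟩)) le_rfl
      (fun x hx => by simpa using hb x ⟨ha.1.trans hx.1, hx.2.le⟩) s ⟨h, hs.2⟩
    rw [gronwallBound_ε0] at this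
    exact this.trans (hexp _ (by linarith [hs.2, ha.1]))
  · have := norm_le_gronwallBound_of_norm_deriv_right_le (f := fun r => δ (-r))
      (f' := fun r => -δ' (-r)) (δ := ‖δ a‖) (K := K)
      (ε := 0) (a := -a) (b := 0)
      (hc.comp continuous_neg.continuousOn fun r hr =>
        ⟨by linarith [hr.2], by linarith [hr.1, ha.2]⟩)
      (fun x hx => ?_) (by simp)
      (fun x hx => by simpa using hb (-x) ⟨by linarith [hx.2], by linarith [hx.1, ha.2]⟩)
      (-s) ⟨by linarith, by linarith [hs.1]⟩
    · rw [gronwallBound_ε0] at this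
      simp only [neg_neg] at this
      exact this.trans (hexp _ (by linarith [hs.1, ha.2]))
    · have h1 := (hd (-x) ⟨by linarith [hx.2], by linarith [hx.1, ha.2]⟩).mono_of_mem_nhdsWithin
        (Icc_mem_nhdsLE_of_mem ⟨by linarith [hx.2], by linarith [hx.1, ha.2]⟩)
      have := h1.scomp x (hasDerivAt_neg x).hasDerivWithinAt (s := Ici x)
        (fun y hy => by simp only [mem_Iic, mem_Ici] at *; linarith)
      simpa using! this

/-! ### The truncated Loewner vector field -/

/-- The field `2 / w`, truncated inside the ball of radius `ε`. -/
def truncField (ε : ℝ) (w : ℂ) : ℂ := 2 * (starRingEnd ℂ w) / ((max ‖w‖ ε : ℝ) : ℂ) ^ 2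

lemma truncField_eq {ε : ℝ} {w : ℂ} (hε : 0 < ε) (h : ε ≤ ‖w‖) : truncField ε w = 2 / w := by
  have hw : w ≠ 0 := norm_pos_iff.1 (hε.trans_le h)
  rw [truncField, max_eq_left h, div_eq_div_iff (by simpa using hw) hw, mul_assoc,
    mul_comm _ w, Complex.mul_conj, Complex.normSq_eq_norm_sq]
  push_cast
  ring

lemma norm_truncField_le {ε : ℝ} (hε : 0 < ε) (w : ℂ) : ‖truncField ε w‖ ≤ 2 / ε := by
  have h1 : ‖w‖ ≤ max ‖w‖ ε := le_max_left _ _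
  have h2 : ε ≤ max ‖w‖ ε := le_max_right _ _
  simp only [truncField, norm_div, norm_mul, norm_pow, Complex.norm_real, RCLike.norm_conj,
    Complex.norm_ofNat, Real.norm_eq_abs, sq_abs]
  rw [div_le_div_iff₀ (by positivity) hε]
  nlinarith [norm_nonneg w, mul_le_mul h1 h2 hε.le (by positivity)]

lemma truncField_lipschitz {ε : ℝ} (hε : 0 < ε) (w₁ w₂ : ℂ) :
    ‖truncField ε w₁ - truncField ε w₂‖ ≤ 6 / ε ^ 2 * ‖w₁ - w₂‖ := by
  set m₁ := max ‖w₁‖ ε with hm₁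
  set m₂ := max ‖w₂‖ ε with hm₂
  have a1 : ‖w₂‖ ≤ m₂ := le_max_left _ _
  have b1 : ε ≤ m₁ := le_max_right _ _
  have b2 : ε ≤ m₂ := le_max_right _ _
  have p1 : 0 < m₁ := hε.trans_le b1
  have p2 : 0 < m₂ := hε.trans_le b2
  have hm : |m₂ - m₁| ≤ ‖w₁ - w₂‖ := by
    refine (abs_max_sub_max_le_abs _ _ _).trans ?_
    rw [norm_sub_rev]; exact abs_norm_sub_norm_le _ _
  have e : truncField ε w₁ - truncField ε w₂ =
      2 * (starRingEnd ℂ (w₁ - w₂)) * ((1 / m₁ ^ 2 : ℝ) : ℂ)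
        + 2 * starRingEnd ℂ w₂ * ((m₂ - m₁ : ℝ) : ℂ) *
          (((m₁ + m₂) / (m₁ ^ 2 * m₂ ^ 2) : ℝ) : ℂ) := by
    simp only [truncField, ← hm₁, ← hm₂, map_sub]
    have q1 : (m₁ : ℂ) ≠ 0 := by exact_mod_cast p1.ne'
    have q2 : (m₂ : ℂ) ≠ 0 := by exact_mod_cast p2.ne'
    push_cast
    field_simp
    ring
  rw [e]
  refine (norm_add_le _ _).trans ?_
  simp only [norm_mul, Complex.norm_real, RCLike.norm_conj, Complex.norm_ofNat, Real.norm_eq_abs]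
  rw [abs_of_pos (show 0 < 1 / m₁ ^ 2 by positivity),
    abs_of_pos (show 0 < (m₁ + m₂) / (m₁ ^ 2 * m₂ ^ 2) by positivity)]
  set d := ‖w₁ - w₂‖
  have hd : 0 ≤ d := norm_nonneg _
  have i1 : 1 / m₁ ^ 2 ≤ 1 / ε ^ 2 := by gcongr
  have i2 : 1 / (m₁ * m₂) ≤ 1 / ε ^ 2 := by rw [sq]; gcongr
  have c1 : 2 * ‖w₂‖ * |m₂ - m₁| * ((m₁ + m₂) / (m₁ ^ 2 * m₂ ^ 2)) ≤
      2 * m₂ * d * ((m₁ + m₂) / (m₁ ^ 2 * m₂ ^ 2)) := by gcongr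
  have c2 : 2 * m₂ * d * ((m₁ + m₂) / (m₁ ^ 2 * m₂ ^ 2)) =
      2 * d * (1 / (m₁ * m₂) + 1 / m₁ ^ 2) := by field_simp
  have c3 : 2 * d * (1 / (m₁ * m₂) + 1 / m₁ ^ 2) ≤ 2 * d * (1 / ε ^ 2 + 1 / ε ^ 2) := by gcongr
  have c4 : 2 * d * (1 / m₁ ^ 2) ≤ 2 * d * (1 / ε ^ 2) := by gcongr
  calc _ ≤ 2 * d * (1 / ε ^ 2) + 2 * d * (1 / ε ^ 2 + 1 / ε ^ 2) := by linarith
    _ = 6 / ε ^ 2 * d := by ring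

lemma exists_truncField_solution {lam : ℝ → ℝ} (hlam : Continuous lam) {ε T a : ℝ} (hε : 0 < ε)
    (ha : a ∈ Icc 0 T) (w : ℂ) :
    ∃ g : ℝ → ℂ, g a = w ∧
      ∀ s ∈ Icc 0 T, HasDerivWithinAt g (truncField ε (g s - lam s)) (Icc 0 T) s := by
  have hT : 0 ≤ T := ha.1.trans ha.2
  have hp : IsPicardLindelof (fun s z => truncField ε (z - lam s)) (tmin := 0) (tmax := T)
      ⟨a, ha⟩ w ⟨2 / ε * T, by positivity⟩ 0 ⟨2 / ε, by positivity⟩ ⟨6 / ε ^ 2, by positivity⟩ := by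
    refine ⟨fun t _ => ?_, fun x _ => ?_, fun t _ x _ => norm_truncField_le hε _, ?_⟩
    · refine (LipschitzWith.of_dist_le_mul fun x y => ?_).lipschitzOnWith
      rw [dist_eq_norm, dist_eq_norm]
      have := truncField_lipschitz hε (x - lam t) (y - lam t)
      rw [sub_sub_sub_cancel_right] at this
      exact this
    · have hL : LipschitzWith ⟨6 / ε ^ 2, by positivity⟩ (truncField ε) :=
        LipschitzWith.of_dist_le_mul fun x y => by
          rw [dist_eq_norm, dist_eq_norm]; exact truncField_lipschitz hε x y
      exact (hL.continuous.comp (continuous_const.sub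
        (Complex.continuous_ofReal.comp hlam))).continuousOn
    · change 2 / ε * max (T - a) (a - 0) ≤ 2 / ε * T - 0
      rw [sub_zero, sub_zero]
      gcongr
      exact max_le (by linarith [ha.1]) ha.2
  exact hp.exists_eq_forall_mem_Icc_hasDerivWithinAt₀

/-! ### Solutions of the Loewner equation on `[0, T]` -/

/-- `g` solves the Loewner equation driven by `lam` on `[0, T]`. -/
def IsLoewnerSol (lam : ℝ → ℝ) (T : ℝ) (g : ℝ → ℂ) : Prop :=
  ∀ s ∈ Icc 0 T, g s ≠ (lam s : ℂ) ∧
    HasDerivWithinAt g (2 / (g s - (lam s : ℂ))) (Icc 0 T) s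

namespace IsLoewnerSol

variable {lam : ℝ → ℝ} {T : ℝ} {g : ℝ → ℂ}

lemma continuousOn (h : IsLoewnerSol lam T g) : ContinuousOn g (Icc 0 T) :=
  fun s hs => (h s hs).2.continuousWithinAt

lemma mono (h : IsLoewnerSol lam T g) {T' : ℝ} (hT : T' ≤ T) : IsLoewnerSol lam T' g :=
  fun s hs => have hs' := Icc_subset_Icc_right hT hs
    ⟨(h s hs').1, (h s hs').2.mono (Icc_subset_Icc_right hT)⟩

lemma of_truncField {ε : ℝ} (hε : 0 < ε)
    (hd : ∀ s ∈ Icc 0 T, HasDerivWithinAt g (truncField ε (g s - lam s)) (Icc 0 T) s)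
    (hg : ∀ s ∈ Icc 0 T, ε ≤ ‖g s - lam s‖) : IsLoewnerSol lam T g := fun s hs =>
  ⟨fun e => absurd (hg s hs) (by simp [e, hε]), truncField_eq hε (hg s hs) ▸ hd s hs⟩

lemma truncField {ε : ℝ} (hε : 0 < ε) (h : IsLoewnerSol lam T g)
    (hg : ∀ s ∈ Icc 0 T, ε ≤ ‖g s - lam s‖) :
    ∀ s ∈ Icc 0 T, HasDerivWithinAt g (truncField ε (g s - lam s)) (Icc 0 T) s := fun s hs =>
  (truncField_eq hε (hg s hs)).symm ▸ (h s hs).2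

lemma exists_gap (hlam : Continuous lam) (h : IsLoewnerSol lam T g) :
    ∃ c, 0 < c ∧ ∀ s ∈ Icc 0 T, c ≤ ‖g s - lam s‖ := by
  rcases le_or_gt 0 T with hT | hT
  · obtain ⟨x, hx, hmin⟩ := isCompact_Icc.exists_isMinOn (nonempty_Icc.2 hT)
      ((h.continuousOn.sub (Complex.continuous_ofReal.comp hlam).continuousOn).norm)
    exact ⟨_, norm_pos_iff.2 (sub_ne_zero.2 (h x hx).1), fun s hs => hmin hs⟩
  · exact ⟨1, one_pos, fun s hs => absurd (hs.1.trans hs.2) hT.not_ge⟩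

end IsLoewnerSol

lemma survives_iff {lam : ℝ → ℝ} {T : ℝ} {z : ℂ} :
    Survives lam T z ↔ ∃ g, g 0 = z ∧ IsLoewnerSol lam T g :=
  ⟨fun ⟨g, h0, _, h⟩ => ⟨g, h0, h⟩,
    fun ⟨g, h0, h⟩ => ⟨g, h0, IsLoewnerSol.continuousOn h, h⟩⟩

lemma dist_truncField_solutions_le {lam : ℝ → ℝ} {T ε : ℝ} (hε : 0 < ε) {g₁ g₂ : ℝ → ℂ}
    (h₁ : ∀ s ∈ Icc 0 T, HasDerivWithinAt g₁ (truncField ε (g₁ s - lam s)) (Icc 0 T) s)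
    (h₂ : ∀ s ∈ Icc 0 T, HasDerivWithinAt g₂ (truncField ε (g₂ s - lam s)) (Icc 0 T) s)
    {a s : ℝ} (ha : a ∈ Icc 0 T) (hs : s ∈ Icc 0 T) :
    ‖g₁ s - g₂ s‖ ≤ ‖g₁ a - g₂ a‖ * Real.exp (6 / ε ^ 2 * T) :=
  norm_le_exp_of_deriv_le (δ := fun s => g₁ s - g₂ s) (by positivity)
    (fun s hs => (h₁ s hs).sub (h₂ s hs))
    (fun s _ => by simpa using truncField_lipschitz hε (g₁ s - lam s) (g₂ s - lam s)) ha hs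

namespace IsLoewnerSol

variable {lam : ℝ → ℝ} {T : ℝ} {g g₁ g₂ : ℝ → ℂ}

lemma unique (hlam : Continuous lam) (h₁ : IsLoewnerSol lam T g₁) (h₂ : IsLoewnerSol lam T g₂)
    {a s : ℝ} (ha : a ∈ Icc 0 T) (hs : s ∈ Icc 0 T) (e : g₁ a = g₂ a) : g₁ s = g₂ s := by
  obtain ⟨c₁, hc₁, H₁⟩ := h₁.exists_gap hlam
  obtain ⟨c₂, hc₂, H₂⟩ := h₂.exists_gap hlam
  have hε : 0 < min c₁ c₂ := lt_min hc₁ hc₂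
  have := dist_truncField_solutions_le hε
    (h₁.truncField hε fun s hs => (min_le_left _ _).trans (H₁ s hs))
    (h₂.truncField hε fun s hs => (min_le_right _ _).trans (H₂ s hs)) ha hs
  rw [e, sub_self, norm_zero, zero_mul] at this
  exact sub_eq_zero.1 (norm_le_zero_iff.1 this)

/-- A solution bounded away from the driver is stable under perturbation of its value at one
time. -/
lemma stability (hlam : Continuous lam) (h : IsLoewnerSol lam T g) {c : ℝ} (hc : 0 < c)
    (hg : ∀ s ∈ Icc 0 T, c ≤ ‖g s - lam s‖) {a : ℝ} (ha : a ∈ Icc 0 T) {w : ℂ}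
    (hw : ‖w - g a‖ * Real.exp (24 / c ^ 2 * T) ≤ c / 2) :
    ∃ g' : ℝ → ℂ, g' a = w ∧ IsLoewnerSol lam T g' ∧
      ∀ s ∈ Icc 0 T, ‖g' s - g s‖ ≤ ‖w - g a‖ * Real.exp (24 / c ^ 2 * T) := by
  have hε : 0 < c / 2 := by positivity
  obtain ⟨g', h0, hd⟩ := exists_truncField_solution hlam hε ha w
  have hdist : ∀ s ∈ Icc 0 T, ‖g' s - g s‖ ≤ ‖w - g a‖ * Real.exp (24 / c ^ 2 * T) := by
    intro s hs
    have := dist_truncField_solutions_le hε hd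
      (h.truncField hε fun s hs => by linarith [hg s hs]) ha hs
    rwa [h0, show 6 / (c / 2) ^ 2 = 24 / c ^ 2 by field_simp; norm_num] at this
  refine ⟨g', h0, of_truncField hε hd fun s hs => ?_, hdist⟩
  have h1 := hdist s hs
  have h2 := hg s hs
  have h3 : ‖g s - lam s‖ ≤ ‖g' s - g s‖ + ‖g' s - lam s‖ := by
    rw [norm_sub_rev (g' s)]
    exact norm_sub_le_norm_sub_add_norm_sub _ _ _
  linarith

lemma hasDerivWithinAt_Iic (h : IsLoewnerSol lam T g) {s : ℝ} (hs : s ∈ Ioc 0 T) :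
    HasDerivWithinAt g (2 / (g s - lam s)) (Iic s) s :=
  (h s ⟨hs.1.le, hs.2⟩).2.mono_of_mem_nhdsWithin (Icc_mem_nhdsLE_of_mem hs)

lemma normSq_pos (h : IsLoewnerSol lam T g) {s : ℝ} (hs : s ∈ Icc 0 T) :
    0 < ((g s).re - lam s) ^ 2 + (g s).im ^ 2 := by
  have := Complex.normSq_pos.2 (sub_ne_zero.2 (h s hs).1)
  rw [Complex.normSq_apply] at this
  simp only [sub_re, ofReal_re, sub_im, ofReal_im, sub_zero] at this
  nlinarith

lemma re_deriv (h : IsLoewnerSol lam T g) {s : ℝ} (hs : s ∈ Ioc 0 T) :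
    HasDerivWithinAt (fun s => (g s).re)
      (2 * ((g s).re - lam s) / (((g s).re - lam s) ^ 2 + (g s).im ^ 2)) (Iic s) s := by
  have := Complex.reCLM.hasFDerivAt.comp_hasDerivWithinAt s (h.hasDerivWithinAt_Iic hs)
  refine this.congr_deriv ?_
  simp [Complex.div_re, Complex.normSq_apply, sq]

lemma im_deriv (h : IsLoewnerSol lam T g) {s : ℝ} (hs : s ∈ Ioc 0 T) :
    HasDerivWithinAt (fun s => (g s).im)
      (-2 * (g s).im / (((g s).re - lam s) ^ 2 + (g s).im ^ 2)) (Iic s) s := by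
  have := Complex.imCLM.hasFDerivAt.comp_hasDerivWithinAt s (h.hasDerivWithinAt_Iic hs)
  refine this.congr_deriv ?_
  simp [Complex.div_im, Complex.normSq_apply, sq, neg_div]

lemma im_sq_deriv (h : IsLoewnerSol lam T g) {s : ℝ} (hs : s ∈ Ioc 0 T) :
    HasDerivWithinAt (fun s => (g s).im ^ 2)
      (-4 * (g s).im ^ 2 / (((g s).re - lam s) ^ 2 + (g s).im ^ 2)) (Iic s) s :=
  ((h.im_deriv hs).pow 2).congr_deriv (by simp; ring)

lemma im_continuousOn (h : IsLoewnerSol lam T g) : ContinuousOn (fun s => (g s).im) (Icc 0 T) :=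
  Complex.continuous_im.comp_continuousOn h.continuousOn

lemma re_continuousOn (h : IsLoewnerSol lam T g) : ContinuousOn (fun s => (g s).re) (Icc 0 T) :=
  Complex.continuous_re.comp_continuousOn h.continuousOn

lemma im_sq_anti (h : IsLoewnerSol lam T g) {a b : ℝ} (ha : 0 ≤ a) (hab : a ≤ b) (hb : b ≤ T) :
    (g b).im ^ 2 ≤ (g a).im ^ 2 := by
  have := le_of_deriv_left_nonneg (f := fun s => -(g s).im ^ 2) hab
    (((h.im_continuousOn.pow 2).neg).mono (Icc_subset_Icc ha hb))
    (fun x hx => (h.im_sq_deriv ⟨ha.trans_lt hx.1, hx.2.trans hb⟩).neg)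
    (fun x hx => by
      have := h.normSq_pos ⟨(ha.trans_lt hx.1).le, hx.2.trans hb⟩
      rw [neg_mul, neg_div, neg_neg]; positivity)
  linarith

lemma im_sq_growth (h : IsLoewnerSol lam T g) {a b : ℝ} (ha : 0 ≤ a) (hab : a ≤ b) (hb : b ≤ T) :
    (g a).im ^ 2 ≤ (g b).im ^ 2 + 4 * (b - a) := by
  have := le_of_deriv_left_nonneg (f := fun s => (g s).im ^ 2 + 4 * s) hab
    (((h.im_continuousOn.pow 2).mono (Icc_subset_Icc ha hb)).add
      (continuous_const.mul continuous_id).continuousOn)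
    (fun x hx => (h.im_sq_deriv ⟨ha.trans_lt hx.1, hx.2.trans hb⟩).add
      ((hasDerivWithinAt_id _ _).const_mul 4))
    (fun x hx => by
      have := h.normSq_pos ⟨(ha.trans_lt hx.1).le, hx.2.trans hb⟩
      have h2 : 4 * (g x).im ^ 2 / (((g x).re - lam x) ^ 2 + (g x).im ^ 2) ≤ 4 := by
        rw [div_le_iff₀ this]; nlinarith [sq_nonneg ((g x).re - lam x)]
      rw [neg_mul, neg_div]; linarith)
  linarith

lemma im_pos (h : IsLoewnerSol lam T g) (hne : (g T).im ≠ 0) {a s : ℝ} (ha : a ∈ Icc 0 T)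
    (hpos : 0 < (g a).im) (hs : s ∈ Icc 0 T) : 0 < (g s).im := by
  by_contra! hcon
  have : (0 : ℝ) ∈ (fun s => (g s).im) '' Icc 0 T :=
    (isPreconnected_Icc.image _ h.im_continuousOn).ordConnected.out
      (mem_image_of_mem _ hs) (mem_image_of_mem _ ha) ⟨hcon, hpos.le⟩
  obtain ⟨r, hr, h0⟩ := this
  have := h.im_sq_anti hr.1 hr.2 le_rfl
  simp only at h0
  rw [h0] at this
  exact hne (pow_eq_zero_iff two_ne_zero |>.1 (le_antisymm (by simpa using this) (sq_nonneg _)))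

lemma im_eq_zero (h : IsLoewnerSol lam T g) (h0 : (g 0).im = 0) {s : ℝ} (hs : s ∈ Icc 0 T) :
    (g s).im = 0 := by
  have := h.im_sq_anti le_rfl hs.1 hs.2
  rw [h0] at this
  exact pow_eq_zero_iff two_ne_zero |>.1 (le_antisymm (by simpa using this) (sq_nonneg _))

end IsLoewnerSol

lemma exists_terminal_solution {lam : ℝ → ℝ} (hlam : Continuous lam) {T : ℝ} (hT : 0 ≤ T) {w : ℂ}
    (hw : 0 < w.im) : ∃ g : ℝ → ℂ, g T = w ∧ IsLoewnerSol lam T g := by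
  obtain ⟨g, hgT, hd⟩ := exists_truncField_solution hlam hw (right_mem_Icc.2 hT) w
  have hc : ContinuousOn g (Icc 0 T) := fun s hs => (hd s hs).continuousWithinAt
  refine ⟨g, hgT, IsLoewnerSol.of_truncField hw hd fun s hs => ?_⟩
  have key := le_of_deriv_left_nonneg (f := fun s => -(g s).im ^ 2) hs.2
    ((((Complex.continuous_im.comp_continuousOn hc).pow 2).neg).mono (Icc_subset_Icc_left hs.1))
    (fun x hx => ((Complex.imCLM.hasFDerivAt.comp_hasDerivWithinAt x
      ((hd x ⟨hs.1.trans hx.1.le, hx.2⟩).mono_of_mem_nhdsWithin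
        (Icc_mem_nhdsLE_of_mem ⟨hs.1.trans_lt hx.1, hx.2⟩))).pow 2).neg)
    (fun x hx => by
      have e : (truncField w.im (g x - lam x)).im =
          -2 * (g x).im / (max ‖g x - lam x‖ w.im) ^ 2 := by
        rw [truncField, ← Complex.ofReal_pow, Complex.div_ofReal_im]
        simp
      have hm : 0 < max ‖g x - lam x‖ w.im := lt_max_of_lt_right hw
      simp only [Complex.imCLM_apply, Function.comp, e]
      have : 0 ≤ 4 * (g x).im ^ 2 / (max ‖g x - lam x‖ w.im) ^ 2 := by positivity
      calc (0:ℝ) ≤ _ := this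
        _ = _ := by push_cast; ring)
  rw [hgT] at key
  have h1 : w.im ≤ |(g s).im| := by
    rw [← abs_of_pos hw]; exact sq_le_sq.1 (by linarith)
  refine h1.trans ?_
  simpa using Complex.abs_im_le_norm (g s - lam s)

/-! ### Contraction of the backward flow near the driver -/

/-- On `(0, T]`, the function `lam` has left derivatives bounded by `M`. -/
def LeftDerivBound (lam : ℝ → ℝ) (T M : ℝ) : Prop :=
  ∀ s ∈ Ioc 0 T, ∃ d, |d| ≤ M ∧ HasDerivWithinAt lam d (Iic s) s

lemma LeftDerivBound.mono {lam : ℝ → ℝ} {T M T' : ℝ} (h : LeftDerivBound lam T M) (hT : T' ≤ T) :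
    LeftDerivBound lam T' M := fun s hs => h s ⟨hs.1, hs.2.trans hT⟩

namespace IsLoewnerSol

variable {lam : ℝ → ℝ} {T M : ℝ} {g g₁ g₂ : ℝ → ℂ}

lemma re_sq_deriv (h : IsLoewnerSol lam T g) {s d : ℝ} (hs : s ∈ Ioc 0 T)
    (hd : HasDerivWithinAt lam d (Iic s) s) :
    HasDerivWithinAt (fun s => ((g s).re - lam s) ^ 2)
      (4 * ((g s).re - lam s) ^ 2 / (((g s).re - lam s) ^ 2 + (g s).im ^ 2)
        - 2 * ((g s).re - lam s) * d) (Iic s) s :=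
  (((h.re_deriv hs).sub hd).pow 2).congr_deriv (by simp; ring)

lemma re_sub_continuousOn (hlam : Continuous lam) (h : IsLoewnerSol lam T g) :
    ContinuousOn (fun s => (g s).re - lam s) (Icc 0 T) :=
  h.re_continuousOn.sub hlam.continuousOn

lemma abs_re_sub_le (hlam : Continuous lam) (hM : 1 ≤ M) (hd : LeftDerivBound lam T M)
    (h : IsLoewnerSol lam T g) {b : ℝ} (hb : 0 < b) (hT : |(g T).re - lam T| ≤ b) {s : ℝ}
    (hs : s ∈ Icc 0 T) : |(g s).re - lam s| ≤ b + 2 * M * (T - s) := by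
  choose! d hdM hd using hd
  have hpos : ∀ r ≤ T, 0 < b + 2 * M * (T - r) := fun r hr => by
    have : 0 ≤ 2 * M * (T - r) := by have := sub_nonneg.2 hr; positivity
    linarith
  have key := fence_left (f := fun s => ((g s).re - lam s) ^ 2)
    (B := fun r => (b + 2 * M * (T - r)) ^ 2)
    (B' := fun r => -(4 * M * (b + 2 * M * (T - r)))) hs.2
    (((h.re_sub_continuousOn hlam).pow 2).mono (Icc_subset_Icc_left hs.1))
    (fun x hx => h.re_sq_deriv ⟨hs.1.trans_lt hx.1, hx.2⟩ (hd x ⟨hs.1.trans_lt hx.1, hx.2⟩))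
    (fun x => by
      have := (((hasDerivAt_id x).const_sub T).const_mul (2 * M)).const_add b |>.pow 2
      refine this.congr_deriv ?_
      simp; ring)
    (by simpa using sq_le_sq' (by linarith [neg_abs_le ((g T).re - lam T)])
          ((le_abs_self _).trans hT)) ?_
  · exact abs_le_of_sq_le_sq key (hpos s hs.2).le
  · intro x hx he
    have hx' : x ∈ Ioc 0 T := ⟨hs.1.trans_lt hx.1, hx.2⟩
    have hN := h.normSq_pos ⟨hx'.1.le, hx'.2⟩
    have hp := hpos x hx.2
    have he' : |(g x).re - lam x| = b + 2 * M * (T - x) := by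
      rw [← abs_of_pos hp]; exact (sq_eq_sq_iff_abs_eq_abs _ _).1 he
    have h1 : 0 ≤ 4 * ((g x).re - lam x) ^ 2 / (((g x).re - lam x) ^ 2 + (g x).im ^ 2) := by
      positivity
    have h2 : ((g x).re - lam x) * d x ≤ (b + 2 * M * (T - x)) * M := by
      rw [← he']
      refine (le_abs_self _).trans ?_
      rw [abs_mul]
      gcongr
      exact hdM x hx'
    have h3 : 0 < M * (b + 2 * M * (T - x)) := by positivity
    linarith

/-- Near the terminal time the backward flow is pushed into vertical cones at the driver. -/
lemma cone (hlam : Continuous lam) (hM : 1 ≤ M) (hd : LeftDerivBound lam T M)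
    (h : IsLoewnerSol lam T g) {κ : ℝ} (hκ : 1 / 4 ≤ κ) (hκ' : κ ≤ 4)
    (hT : |(g T).re - lam T| ≤ 1 / (8 * M)) {s : ℝ} (hs : s ∈ Icc 0 T)
    (hs' : T - s ≤ 1 / (8 * M ^ 2)) :
    (g T).im ^ 2 - κ * ((g T).re - lam T) ^ 2 + (T - s) / 2 ≤
      (g s).im ^ 2 - κ * ((g s).re - lam s) ^ 2 := by
  have hX := fun r hr => h.abs_re_sub_le hlam hM hd (b := 1 / (8 * M)) (by positivity) hT (s := r)
    hr
  choose! d hdM hd using hd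
  have key := le_of_deriv_left_nonneg
    (f := fun r => κ * ((g r).re - lam r) ^ 2 - (g r).im ^ 2 - r / 2) hs.2
    (((((h.re_sub_continuousOn hlam).pow 2).const_smul κ).sub (h.im_continuousOn.pow 2)).sub
      (continuous_id.div_const 2).continuousOn |>.mono (Icc_subset_Icc_left hs.1))
    (fun x hx => (((h.re_sq_deriv ⟨hs.1.trans_lt hx.1, hx.2⟩
      (hd x ⟨hs.1.trans_lt hx.1, hx.2⟩)).const_mul κ).sub
        (h.im_sq_deriv ⟨hs.1.trans_lt hx.1, hx.2⟩)).sub ((hasDerivWithinAt_id _ _).div_const 2)) ?_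
  · linarith
  · intro x hx
    have hx' : x ∈ Ioc 0 T := ⟨hs.1.trans_lt hx.1, hx.2⟩
    have hN := h.normSq_pos ⟨hx'.1.le, hx'.2⟩
    set X := (g x).re - lam x
    set Y := (g x).im
    have h1 : M * |X| ≤ 3 / 8 := by
      have := hX x ⟨hx'.1.le, hx'.2⟩
      have h2 : T - x ≤ 1 / (8 * M ^ 2) := by linarith [hx.1]
      calc M * |X| ≤ M * (1 / (8 * M) + 2 * M * (1 / (8 * M ^ 2))) := by
            gcongr; refine this.trans ?_; gcongr
        _ = 3 / 8 := by field_simp; norm_num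
    have h2 : X * d x ≤ 3 / 8 := by
      refine ((le_abs_self _).trans ?_).trans h1
      rw [abs_mul, mul_comm]
      gcongr
      exact hdM x hx'
    have h3 : κ * (4 * X ^ 2 / (X ^ 2 + Y ^ 2) - 2 * X * d x) - -4 * Y ^ 2 / (X ^ 2 + Y ^ 2) - 1 / 2
        = 4 * (κ * X ^ 2 + Y ^ 2) / (X ^ 2 + Y ^ 2) - 2 * κ * (X * d x) - 1 / 2 := by ring
    rw [h3]
    have h5 : κ * (X * d x) ≤ κ * (3 / 8) := by gcongr
    rcases le_total κ 1 with hk | hk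
    · have h4 : 4 * κ ≤ 4 * (κ * X ^ 2 + Y ^ 2) / (X ^ 2 + Y ^ 2) := by
        rw [le_div_iff₀ hN]; nlinarith [mul_nonneg (sub_nonneg.2 hk) (sq_nonneg Y)]
      linarith
    · have h4 : 4 ≤ 4 * (κ * X ^ 2 + Y ^ 2) / (X ^ 2 + Y ^ 2) := by
        rw [le_div_iff₀ hN]; nlinarith [mul_nonneg (sub_nonneg.2 hk) (sq_nonneg X)]
      linarith

lemma sub_sq_deriv (h₁ : IsLoewnerSol lam T g₁) (h₂ : IsLoewnerSol lam T g₂) {s : ℝ}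
    (hs : s ∈ Ioc 0 T) :
    HasDerivWithinAt (fun s => ‖g₁ s - g₂ s‖ ^ 2)
      (-4 * ‖g₁ s - g₂ s‖ ^ 2 * (((g₁ s - lam s) * (g₂ s - lam s))⁻¹).re) (Iic s) s := by
  refine ((h₁.hasDerivWithinAt_Iic hs).sub (h₂.hasDerivWithinAt_Iic hs)).norm_sq.congr_deriv ?_
  have u1 := sub_ne_zero.2 (h₁ s ⟨hs.1.le, hs.2⟩).1
  have u2 := sub_ne_zero.2 (h₂ s ⟨hs.1.le, hs.2⟩).1
  have e : 2 / (g₁ s - lam s) - 2 / (g₂ s - lam s) =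
      -2 * ((g₁ s - g₂ s) * ((g₁ s - lam s) * (g₂ s - lam s))⁻¹) := by
    field_simp; ring
  rw [e, Complex.inner]
  have : (starRingEnd ℂ) (g₁ s - g₂ s) *
      (-2 * ((g₁ s - g₂ s) * ((g₁ s - lam s) * (g₂ s - lam s))⁻¹)) =
      ((-2 * ‖g₁ s - g₂ s‖ ^ 2 : ℝ) : ℂ) * ((g₁ s - lam s) * (g₂ s - lam s))⁻¹ := by
    have := Complex.conj_mul' (g₁ s - g₂ s)
    push_cast
    rw [← this]; ring
  simp only [Pi.sub_apply]
  rw [mul_comm _ (starRingEnd ℂ _), this, Complex.re_ofReal_mul]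
  ring

lemma quarter_sq_le_im_sq (hlam : Continuous lam) (hM : 1 ≤ M) (hd : LeftDerivBound lam T M)
    (h : IsLoewnerSol lam T g) (hT : |(g T).re - lam T| ≤ 1 / (8 * M))
    (hcone : ((g T).re - lam T) ^ 2 ≤ 4 * (g T).im ^ 2) {s : ℝ} (hs : s ∈ Icc 0 T)
    (hs' : 1 / (8 * M ^ 2) ≤ T - s) : (1 / (4 * M)) ^ 2 ≤ (g s).im ^ 2 := by
  have hr : 0 ≤ 1 / (8 * M ^ 2) := by positivity
  have h1 := h.cone hlam hM hd (κ := 1 / 4) le_rfl (by norm_num) hT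
    (s := T - 1 / (8 * M ^ 2)) ⟨by linarith [hs.1], by linarith⟩ (by linarith)
  have h2 := h.im_sq_anti hs.1 (b := T - 1 / (8 * M ^ 2)) (by linarith) (by linarith)
  have h3 : (1 / (4 * M)) ^ 2 = (T - (T - 1 / (8 * M ^ 2))) / 2 := by field_simp; ring
  rw [h3]
  nlinarith [sq_nonneg ((g (T - 1 / (8 * M ^ 2))).re - lam (T - 1 / (8 * M ^ 2)))]

/-- Two solutions whose terminal values lie in suitable cones at the driver start close to each
other if they end close to each other. -/
lemma backward_lipschitz (hlam : Continuous lam) (hM : 1 ≤ M) (hd : LeftDerivBound lam T M)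
    (hT : 0 ≤ T) (h₁ : IsLoewnerSol lam T g₁) (h₂ : IsLoewnerSol lam T g₂)
    (hp₁ : ∀ s ∈ Icc 0 T, 0 < (g₁ s).im) (hp₂ : ∀ s ∈ Icc 0 T, 0 < (g₂ s).im)
    (hT₁ : |(g₁ T).re - lam T| ≤ 1 / (8 * M)) (hT₂ : |(g₂ T).re - lam T| ≤ 1 / (8 * M))
    (hc₁ : 4 * ((g₁ T).re - lam T) ^ 2 ≤ (g₁ T).im ^ 2)
    (hc₂ : ((g₂ T).re - lam T) ^ 2 ≤ 4 * (g₂ T).im ^ 2) :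
    ‖g₁ 0 - g₂ 0‖ ≤ Real.exp (32 * M ^ 2 * T) * ‖g₁ T - g₂ T‖ := by
  have hre : ∀ s ∈ Icc 0 T, (((g₁ s - lam s) * (g₂ s - lam s))⁻¹).re ≤ 16 * M ^ 2 := by
    intro s hs
    rcases le_total (T - s) (1 / (8 * M ^ 2)) with hle | hle
    · refine le_trans ?_ (show (0:ℝ) ≤ 16 * M ^ 2 by positivity)
      have k1 := h₁.cone hlam hM hd (κ := 4) (by norm_num) le_rfl hT₁ hs hle
      have k2 := h₂.cone hlam hM hd (κ := 1 / 4) le_rfl (by norm_num) hT₂ hs hle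
      have y1 := hp₁ s hs
      have y2 := hp₂ s hs
      have x1 : 2 * |(g₁ s).re - lam s| ≤ (g₁ s).im := by
        refine abs_le_of_sq_le_sq' ?_ y1.le |>.2
        rw [mul_pow, sq_abs]; linarith [hs.2]
      have x2 : |(g₂ s).re - lam s| ≤ 2 * (g₂ s).im := by
        refine abs_le_of_sq_le_sq' ?_ (by linarith) |>.2
        rw [mul_pow, sq_abs]; linarith [hs.2]
      rw [Complex.inv_re]
      refine div_nonpos_of_nonpos_of_nonneg ?_ (Complex.normSq_nonneg _)
      simp only [mul_re, sub_re, ofReal_re, sub_im, ofReal_im, sub_zero]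
      have : ((g₁ s).re - lam s) * ((g₂ s).re - lam s) ≤
          |(g₁ s).re - lam s| * |(g₂ s).re - lam s| := by rw [← abs_mul]; exact le_abs_self _
      have h3 := mul_le_mul x1 x2 (abs_nonneg _) y1.le
      linarith
    · have aux : ∀ g : ℝ → ℂ, (1 / (4 * M)) ^ 2 ≤ (g s).im ^ 2 → 1 / (4 * M) ≤ ‖g s - lam s‖ :=
        fun g hg => by
          refine (abs_le_of_sq_le_sq' (a := 1 / (4 * M)) (b := |(g s).im|) (by rwa [sq_abs])
            (abs_nonneg _)).2.trans ?_
          simpa using Complex.abs_im_le_norm (g s - lam s)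
      have n1 := aux g₁ (h₁.quarter_sq_le_im_sq hlam hM hd hT₁
        (by nlinarith [sq_nonneg ((g₁ T).re - lam T), sq_nonneg (g₁ T).im]) hs hle)
      have n2 := aux g₂ (h₂.quarter_sq_le_im_sq hlam hM hd hT₂ hc₂ hs hle)
      refine (Complex.re_le_norm _).trans ?_
      rw [norm_inv, norm_mul]
      calc (‖g₁ s - lam s‖ * ‖g₂ s - lam s‖)⁻¹ ≤ (1 / (4 * M) * (1 / (4 * M)))⁻¹ := by gcongr
        _ = 16 * M ^ 2 := by field_simp; norm_num
  have hexp : ∀ s : ℝ, HasDerivAt (fun s => Real.exp (64 * M ^ 2 * s))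
      (64 * M ^ 2 * Real.exp (64 * M ^ 2 * s)) s := fun s =>
    (((hasDerivAt_id s).const_mul (64 * M ^ 2)).exp).congr_deriv (by simp [mul_comm])
  have key := le_of_deriv_left_nonneg
    (f := fun s => Real.exp (64 * M ^ 2 * s) * ‖g₁ s - g₂ s‖ ^ 2) hT
    ((by fun_prop : Continuous fun s => Real.exp (64 * M ^ 2 * s)).continuousOn.mul
      ((h₁.continuousOn.sub h₂.continuousOn).norm.pow 2))
    (fun x hx => (hexp x).hasDerivWithinAt.mul (h₁.sub_sq_deriv h₂ hx))
    (fun x hx => by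
      have := hre x ⟨hx.1.le, hx.2⟩
      set e := Real.exp (64 * M ^ 2 * x)
      set n := ‖g₁ x - g₂ x‖ ^ 2
      set q := (((g₁ x - lam x) * (g₂ x - lam x))⁻¹).re
      have : 0 ≤ 4 * e * n * (16 * M ^ 2 - q) := by
        have := sub_nonneg.2 this; positivity
      linarith)
  simp only [mul_zero, Real.exp_zero, one_mul] at key
  refine abs_le_of_sq_le_sq' ?_ (by positivity) |>.2
  rw [mul_pow, ← Real.exp_nat_mul]
  rwa [show ((2 : ℕ) : ℝ) * (32 * M ^ 2 * T) = 64 * M ^ 2 * T by push_cast; ring]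

end IsLoewnerSol

/-! ### The trace -/

/-- `γ t` is the vertical limit at `lam t` of the inverse Loewner map, with the expected rate. -/
def IsTrace (lam : ℝ → ℝ) (γ : ℝ → ℂ) : Prop :=
  ∀ t ∈ Ico (0:ℝ) 1, ∀ M, 1 ≤ M → LeftDerivBound lam t M → ∀ y : ℝ, 0 < y → ∀ g : ℝ → ℂ,
    g t = lam t + y * I → IsLoewnerSol lam t g → ‖g 0 - γ t‖ ≤ Real.exp (32 * M ^ 2) * y

lemma vertical_re (a y : ℝ) : ((a : ℂ) + y * I).re = a := by simp

lemma vertical_im (a y : ℝ) : ((a : ℂ) + y * I).im = y := by simp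

lemma IsLoewnerSol.dist_zero_le {lam : ℝ → ℝ} {t M y : ℝ} {g₁ g₂ : ℝ → ℂ} (hlam : Continuous lam)
    (ht : t ∈ Ico (0:ℝ) 1) (hM : 1 ≤ M) (hd : LeftDerivBound lam t M) (hy : 0 < y)
    (e : g₁ t = lam t + y * I) (h₁ : IsLoewnerSol lam t g₁) (h₂ : IsLoewnerSol lam t g₂)
    (hT : |(g₂ t).re - lam t| ≤ 1 / (8 * M)) (hp : 0 < (g₂ t).im)
    (hc : ((g₂ t).re - lam t) ^ 2 ≤ 4 * (g₂ t).im ^ 2) :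
    ‖g₁ 0 - g₂ 0‖ ≤ Real.exp (32 * M ^ 2) * ‖g₁ t - g₂ t‖ := by
  have ht' := right_mem_Icc.2 ht.1
  have hre : (g₁ t).re - lam t = 0 := by simp [e]
  have him : (g₁ t).im = y := by simp [e]
  refine (h₁.backward_lipschitz hlam hM hd ht.1 h₂
    (fun s hs => h₁.im_pos (him ▸ hy.ne') ht' (him ▸ hy) hs)
    (fun s hs => h₂.im_pos hp.ne' ht' hp hs)
    (by rw [hre, abs_zero]; positivity) hT (by rw [hre, him]; nlinarith) hc).trans ?_
  exact mul_le_mul_of_nonneg_right (Real.exp_le_exp.2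
    (mul_le_of_le_one_right (by positivity) ht.2.le)) (norm_nonneg _)

lemma exists_vertical_solution {lam : ℝ → ℝ} (hlam : Continuous lam) {t y : ℝ} (ht : 0 ≤ t)
    (hy : 0 < y) : ∃ g : ℝ → ℂ, g t = lam t + y * I ∧ IsLoewnerSol lam t g :=
  exists_terminal_solution hlam ht (by simpa using hy)

lemma exists_isTrace {lam : ℝ → ℝ} (hlam : Continuous lam)
    (hd : ∀ t < 1, ∃ M, 1 ≤ M ∧ LeftDerivBound lam t M) : ∃ γ, IsTrace lam γ := by
  suffices H : ∀ t ∈ Ico (0:ℝ) 1, ∃ p : ℂ, ∀ M, 1 ≤ M → LeftDerivBound lam t M → ∀ y : ℝ, 0 < y →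
      ∀ g : ℝ → ℂ, g t = lam t + y * I → IsLoewnerSol lam t g →
        ‖g 0 - p‖ ≤ Real.exp (32 * M ^ 2) * y by
    choose! γ hγ using H
    exact ⟨γ, hγ⟩
  intro t ht
  have hyn : ∀ n : ℕ, (0:ℝ) < 1 / (n + 1) := fun n => Nat.one_div_pos_of_nat
  choose G hG hGs using fun n => exists_vertical_solution hlam ht.1 (hyn n)
  have comp : ∀ M, 1 ≤ M → LeftDerivBound lam t M → ∀ y : ℝ, 0 < y → ∀ g : ℝ → ℂ,
      g t = lam t + y * I → IsLoewnerSol lam t g → ∀ n,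
        ‖g 0 - G n 0‖ ≤ Real.exp (32 * M ^ 2) * |y - 1 / (n + 1)| := by
    intro M hM hd y hy g hg hgs n
    refine (IsLoewnerSol.dist_zero_le hlam ht hM hd hy hg hgs (hGs n) ?_ ?_ ?_).trans_eq ?_
    · rw [hG, vertical_re, sub_self, abs_zero]; positivity
    · rw [hG, vertical_im]; exact hyn n
    · rw [hG, vertical_re, vertical_im, sub_self, zero_pow two_ne_zero]; positivity
    · rw [hg, hG, add_sub_add_left_eq_sub, ← sub_mul, ← ofReal_sub, norm_mul, norm_I, mul_one,
        norm_real, Real.norm_eq_abs]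
  obtain ⟨M₀, hM₀, hd₀⟩ := hd t ht.2
  have hcau : CauchySeq fun n => G n 0 := by
    refine cauchySeq_of_le_tendsto_0 (fun n : ℕ => Real.exp (32 * M₀ ^ 2) * (1 / ((n : ℝ) + 1)))
      (fun n m N hn hm => ?_) ?_
    · rw [dist_eq_norm]
      refine (comp M₀ hM₀ hd₀ _ (hyn n) _ (hG n) (hGs n) m).trans ?_
      gcongr
      have h1 : (1:ℝ) / (n + 1) ≤ 1 / (N + 1) := by gcongr
      have h2 : (1:ℝ) / (m + 1) ≤ 1 / (N + 1) := by gcongr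
      rw [abs_le]
      constructor <;> linarith [hyn n, hyn m]
    · simpa using tendsto_one_div_add_atTop_nhds_zero_nat.const_mul (Real.exp (32 * M₀ ^ 2))
  obtain ⟨p, hp⟩ := cauchySeq_tendsto_of_complete hcau
  refine ⟨p, fun M hM hd y hy g hg hgs => ?_⟩
  refine le_of_tendsto_of_tendsto' (tendsto_const_nhds.sub hp).norm ?_
    (comp M hM hd y hy g hg hgs)
  have := ((tendsto_one_div_add_atTop_nhds_zero_nat (𝕜 := ℝ)).const_sub y).abs.const_mul
    (Real.exp (32 * M ^ 2))
  simpa [abs_of_pos hy] using this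

namespace IsTrace

variable {lam : ℝ → ℝ} {γ : ℝ → ℂ} {t M : ℝ} {g : ℝ → ℂ}

lemma dist_le (hγ : IsTrace lam γ) (hlam : Continuous lam) (ht : t ∈ Ico (0:ℝ) 1) (hM : 1 ≤ M)
    (hd : LeftDerivBound lam t M) (h : IsLoewnerSol lam t g)
    (hT : |(g t).re - lam t| ≤ 1 / (8 * M)) (hp : 0 < (g t).im)
    (hc : ((g t).re - lam t) ^ 2 ≤ 4 * (g t).im ^ 2) :
    ‖g 0 - γ t‖ ≤ Real.exp (32 * M ^ 2) * ‖g t - lam t‖ := by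
  set C := Real.exp (32 * M ^ 2)
  have hC : 0 < C := Real.exp_pos _
  refine le_of_forall_pos_le_add fun ε hε => ?_
  have hy : 0 < ε / (2 * C) := by positivity
  obtain ⟨f, hf, hfs⟩ := exists_vertical_solution hlam ht.1 hy
  have h1 := hγ t ht M hM hd _ hy f hf hfs
  have h2 := IsLoewnerSol.dist_zero_le hlam ht hM hd hy hf hfs h hT hp hc
  have h3 : ‖f t - g t‖ ≤ ε / (2 * C) + ‖g t - lam t‖ := by
    have : f t - g t = (ε / (2 * C) : ℝ) * I - (g t - lam t) := by rw [hf]; ring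
    rw [this]
    refine (norm_sub_le _ _).trans ?_
    rw [norm_mul, norm_I, mul_one, norm_real, Real.norm_eq_abs, abs_of_pos hy]
  calc ‖g 0 - γ t‖ ≤ ‖f 0 - g 0‖ + ‖f 0 - γ t‖ := by
        rw [norm_sub_rev (f 0) (g 0)]; exact norm_sub_le_norm_sub_add_norm_sub _ _ _
    _ ≤ C * (ε / (2 * C) + ‖g t - lam t‖) + C * (ε / (2 * C)) := by
        refine add_le_add (h2.trans ?_) h1
        gcongr
    _ = C * ‖g t - lam t‖ + ε := by field_simp; ring

lemma apply_zero (hγ : IsTrace lam γ) (hlam : Continuous lam)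
    (hd : ∀ t < 1, ∃ M, 1 ≤ M ∧ LeftDerivBound lam t M) : γ 0 = lam 0 := by
  obtain ⟨M, hM, hd⟩ := hd 0 one_pos
  rw [← sub_eq_zero, ← norm_le_zero_iff]
  refine le_of_forall_pos_le_add fun ε hε => ?_
  set C := Real.exp (32 * M ^ 2)
  have hC : 0 < C := Real.exp_pos _
  have hy : 0 < ε / (C + 1) := by positivity
  obtain ⟨f, hf, hfs⟩ := exists_vertical_solution hlam le_rfl hy
  have h1 := hγ 0 ⟨le_rfl, one_pos⟩ M hM hd _ hy f hf hfs
  have h2 : ‖f 0 - lam 0‖ = ε / (C + 1) := by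
    rw [hf, add_sub_cancel_left, norm_mul, norm_I, mul_one, norm_real, Real.norm_eq_abs,
      abs_of_pos hy]
  calc ‖γ 0 - lam 0‖ ≤ ‖f 0 - γ 0‖ + ‖f 0 - lam 0‖ := by
        rw [norm_sub_rev (f 0) (γ 0)]; exact norm_sub_le_norm_sub_add_norm_sub _ _ _
    _ ≤ C * (ε / (C + 1)) + ε / (C + 1) := by rw [h2]; gcongr
    _ = 0 + ε := by field_simp; ring

lemma dist_le_sqrt (hγ : IsTrace lam γ) (hlam : Continuous lam) {t' : ℝ} (ht : 0 ≤ t)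
    (htt : t < t') (ht' : t' < 1) (hM : 1 ≤ M) (hd : LeftDerivBound lam t' M)
    (hδ : √(t' - t) ≤ 1 / (16 * M)) :
    ‖γ t' - γ t‖ ≤ 6 * Real.exp (32 * M ^ 2) * √(t' - t) := by
  set C := Real.exp (32 * M ^ 2)
  have hC : 0 < C := Real.exp_pos _
  set y := √(t' - t) with hy_def
  have hy : 0 < y := Real.sqrt_pos.2 (sub_pos.2 htt)
  have hsq : y ^ 2 = t' - t := Real.sq_sqrt (sub_pos.2 htt).le
  obtain ⟨f, hf, hfs⟩ := exists_vertical_solution hlam (ht.trans htt.le) hy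
  have h1 := hγ t' ⟨ht.trans htt.le, ht'⟩ M hM hd _ hy f hf hfs
  have hre : (f t').re - lam t' = 0 := by simp [hf]
  have him : (f t').im = y := by simp [hf]
  have htm : t ∈ Icc 0 t' := ⟨ht, htt.le⟩
  have hMy : M * y ≤ 1 / 16 := by
    calc M * y ≤ M * (1 / (16 * M)) := by gcongr
      _ = 1 / 16 := by field_simp
  have hX := hfs.abs_re_sub_le hlam hM hd hy (by rw [hre, abs_zero]; exact hy.le) htm
  rw [← hsq] at hX
  have hX' : |(f t).re - lam t| ≤ 9 / 8 * y := by nlinarith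
  have hb : 9 / 8 * y ≤ 1 / (8 * M) := by
    rw [le_div_iff₀ (by positivity)]; linarith
  have hY := hfs.im_sq_growth ht htt.le le_rfl
  have hY0 : 0 < (f t).im := hfs.im_pos (him ▸ hy.ne') (right_mem_Icc.2 (ht.trans htt.le))
    (him ▸ hy) htm
  have hY' : |(f t).im| ≤ 9 / 4 * y := by
    refine abs_le_of_sq_le_sq ?_ (by positivity)
    rw [him, ← hsq] at hY
    nlinarith
  have hcone := hfs.cone hlam hM hd (κ := 1 / 4) le_rfl (by norm_num)
    (by rw [hre, abs_zero]; positivity) htm (by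
      rw [← hsq, le_div_iff₀ (by positivity)]
      have : y ^ 2 * (8 * M ^ 2) = 8 * (M * y) ^ 2 := by ring
      rw [this]
      nlinarith [mul_pos (one_pos.trans_le hM) hy])
  rw [hre, him] at hcone
  have h2 := hγ.dist_le hlam ⟨ht, htt.trans ht'⟩ hM (hd.mono htt.le) (hfs.mono htt.le)
    (hX'.trans hb) hY0 (by nlinarith [sq_nonneg y])
  have h3 : ‖f t - lam t‖ ≤ 9 / 8 * y + 9 / 4 * y := by
    refine (Complex.norm_le_abs_re_add_abs_im _).trans (add_le_add ?_ ?_)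
    · simpa using hX'
    · simpa using hY'
  calc ‖γ t' - γ t‖ ≤ ‖f 0 - γ t'‖ + ‖f 0 - γ t‖ := by
        rw [norm_sub_rev (f 0) (γ t')]; exact norm_sub_le_norm_sub_add_norm_sub _ _ _
    _ ≤ C * y + C * (9 / 8 * y + 9 / 4 * y) := add_le_add h1 (h2.trans (by gcongr))
    _ ≤ 6 * C * y := by nlinarith [mul_pos hC hy]

lemma continuousOn (hγ : IsTrace lam γ) (hlam : Continuous lam)
    (hd : ∀ t < 1, ∃ M, 1 ≤ M ∧ LeftDerivBound lam t M) : ContinuousOn γ (Ico 0 1) := by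
  intro t ht
  obtain ⟨T, htT, hT⟩ := exists_between ht.2
  obtain ⟨M, hM, hd⟩ := hd T hT
  have hcont : Tendsto (fun s => √|s - t|) (nhds t) (nhds 0) := by
    have : Continuous fun s => √|s - t| := by fun_prop
    simpa using this.tendsto t
  have hsmall : ∀ᶠ s in nhdsWithin t (Ico 0 1), √|s - t| ≤ 1 / (16 * M) :=
    (hcont.eventually_le_const (by positivity)).filter_mono nhdsWithin_le_nhds
  have hlt : ∀ᶠ s in nhdsWithin t (Ico 0 1), s < T :=
    (eventually_lt_nhds htT).filter_mono nhdsWithin_le_nhds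
  rw [ContinuousWithinAt, tendsto_iff_norm_sub_tendsto_zero]
  refine squeeze_zero' (.of_forall fun _ => norm_nonneg _) ?_
    (g := fun s => 6 * Real.exp (32 * M ^ 2) * √|s - t|) ?_
  · filter_upwards [hsmall, hlt, self_mem_nhdsWithin] with s h1 h2 h3
    rcases lt_trichotomy s t with h | rfl | h
    · rw [norm_sub_rev, abs_sub_comm, abs_of_pos (sub_pos.2 h)] at *
      exact hγ.dist_le_sqrt hlam h3.1 h ht.2 hM (hd.mono htT.le) h1
    · simp
    · rw [abs_of_pos (sub_pos.2 h)] at *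
      exact hγ.dist_le_sqrt hlam ht.1 h h3.2 hM (hd.mono h2.le) h1
  · simpa using (hcont.const_mul (6 * Real.exp (32 * M ^ 2))).mono_left nhdsWithin_le_nhds

end IsTrace

lemma IsLoewnerSol.im_gap_of_vertical {lam : ℝ → ℝ} {t M y : ℝ} {g : ℝ → ℂ} (hlam : Continuous lam)
    (hM : 1 ≤ M) (hd : LeftDerivBound lam t M) (e : g t = lam t + y * I)
    (h : IsLoewnerSol lam t g) {s : ℝ} (hs : 0 ≤ s) (hst : s < t) {r : ℝ} (hr : r ∈ Icc 0 s) :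
    √(min (t - s) (1 / (8 * M ^ 2)) / 2) ≤ |(g r).im| := by
  have hre : (g t).re - lam t = 0 := by simp [e]
  set m := min (t - s) (1 / (8 * M ^ 2))
  have hm : 0 < m := lt_min (sub_pos.2 hst) (by positivity)
  have h1 : m ≤ t - s := min_le_left _ _
  have h2 : m ≤ 1 / (8 * M ^ 2) := min_le_right _ _
  have hcone := h.cone hlam hM hd (κ := 1) (by norm_num) (by norm_num)
    (by rw [hre, abs_zero]; positivity) (s := t - m) ⟨by linarith, by linarith⟩ (by linarith)
  have h3 := h.im_sq_anti hr.1 (b := t - m) (by linarith [hr.2]) (by linarith)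
  rw [hre] at hcone
  refine Real.sqrt_le_iff.2 ⟨abs_nonneg _, ?_⟩
  rw [sq_abs]
  nlinarith [sq_nonneg ((g (t - m)).re - lam (t - m)), sq_nonneg (g t).im]

namespace IsTrace

variable {lam : ℝ → ℝ} {γ : ℝ → ℂ} {t M : ℝ} {g : ℝ → ℂ}

lemma im_pos (hγ : IsTrace lam γ) (hlam : Continuous lam)
    (hd : ∀ t < 1, ∃ M, 1 ≤ M ∧ LeftDerivBound lam t M) (ht : t ∈ Ioo (0:ℝ) 1) :
    0 < (γ t).im := by
  obtain ⟨M, hM, hd⟩ := hd t ht.2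
  set C := Real.exp (32 * M ^ 2)
  have hC : 0 < C := Real.exp_pos _
  set c := √(min (t - 0) (1 / (8 * M ^ 2)) / 2)
  have hc : 0 < c := Real.sqrt_pos.2 (half_pos (lt_min (by simpa using ht.1) (by positivity)))
  have hy : 0 < c / (2 * C) := by positivity
  obtain ⟨f, hf, hfs⟩ := exists_vertical_solution hlam ht.1.le hy
  have h1 := hγ t ⟨ht.1.le, ht.2⟩ M hM hd _ hy f hf hfs
  have h2 := hfs.im_gap_of_vertical hlam hM hd hf le_rfl ht.1 (left_mem_Icc.2 le_rfl)
  have him : (f t).im = c / (2 * C) := by rw [hf, vertical_im]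
  have h3 := hfs.im_pos (him ▸ hy.ne') (right_mem_Icc.2 ht.1.le) (him ▸ hy) (left_mem_Icc.2 ht.1.le)
  rw [abs_of_pos h3] at h2
  have h4 := (Complex.abs_im_le_norm _).trans h1
  rw [show C * (c / (2 * C)) = c / 2 by field_simp] at h4
  have h5 := (abs_le.1 h4).2
  rw [sub_im] at h5
  linarith

lemma survives (hγ : IsTrace lam γ) (hlam : Continuous lam)
    (hd : ∀ t < 1, ∃ M, 1 ≤ M ∧ LeftDerivBound lam t M) {s : ℝ} (hs : 0 ≤ s) (hst : s < t)
    (ht : t < 1) : Survives lam s (γ t) := by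
  obtain ⟨M, hM, hd⟩ := hd t ht
  set C := Real.exp (32 * M ^ 2)
  have hC : 0 < C := Real.exp_pos _
  set c := √(min (t - s) (1 / (8 * M ^ 2)) / 2)
  have hc : 0 < c := Real.sqrt_pos.2 (half_pos (lt_min (sub_pos.2 hst) (by positivity)))
  set E := Real.exp (24 / c ^ 2 * s)
  have hE : 0 < E := Real.exp_pos _
  have hy : 0 < c / (2 * C * E) := by positivity
  obtain ⟨f, hf, hfs⟩ := exists_vertical_solution hlam (hs.trans hst.le) hy
  have h1 := hγ t ⟨hs.trans hst.le, ht⟩ M hM hd _ hy f hf hfs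
  obtain ⟨g, hg0, hgs, -⟩ := (hfs.mono hst.le).stability hlam hc
    (fun r hr => (hfs.im_gap_of_vertical hlam hM hd hf hs hst hr).trans
      (by simpa using Complex.abs_im_le_norm (f r - lam r)))
    (left_mem_Icc.2 hs) (w := γ t) (by
      rw [norm_sub_rev]
      calc ‖f 0 - γ t‖ * E ≤ C * (c / (2 * C * E)) * E := by gcongr
        _ = c / 2 := by field_simp)
  exact survives_iff.2 ⟨g, hg0, hgs⟩

lemma not_survives (hγ : IsTrace lam γ) (hlam : Continuous lam)
    (hd : ∀ t < 1, ∃ M, 1 ≤ M ∧ LeftDerivBound lam t M) {s : ℝ} (hs : s ∈ Ico (0:ℝ) 1)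
    (hst : s ≤ t) : ¬ Survives lam t (γ s) := by
  rw [survives_iff]
  rintro ⟨h, h0, hsol⟩
  replace hsol := hsol.mono hst
  obtain ⟨M, hM, hd⟩ := hd s hs.2
  obtain ⟨c, hc, hgap⟩ := hsol.exists_gap hlam
  set C := Real.exp (32 * M ^ 2)
  have hC : 0 < C := Real.exp_pos _
  set E := Real.exp (24 / c ^ 2 * s)
  have hE : 0 < E := Real.exp_pos _
  have hy : 0 < c / (2 * C * E + 4) := by positivity
  obtain ⟨f, hf, hfs⟩ := exists_vertical_solution hlam hs.1 hy
  have h1 := hγ s hs M hM hd _ hy f hf hfs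
  have h2 : ‖f 0 - h 0‖ * E ≤ c / 2 := by
    rw [h0]
    calc ‖f 0 - γ s‖ * E ≤ C * (c / (2 * C * E + 4)) * E := by gcongr
      _ ≤ c / 2 := by
        rw [mul_div_assoc', div_mul_eq_mul_div, div_le_div_iff₀ (by positivity) two_pos]
        nlinarith
  obtain ⟨f', hf0, hfs', hclose⟩ := hsol.stability hlam hc hgap (left_mem_Icc.2 hs.1) h2
  have hsm := right_mem_Icc.2 hs.1
  have h3 := hclose s hsm
  rw [hfs'.unique hlam hfs (left_mem_Icc.2 hs.1) hsm hf0] at h3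
  have h4 : ‖f s - lam s‖ ≤ c / 4 := by
    rw [hf, add_sub_cancel_left, norm_mul, norm_I, mul_one, norm_real, Real.norm_eq_abs,
      abs_of_pos hy]
    gcongr
    nlinarith [mul_pos hC hE]
  have h5 : ‖h s - lam s‖ ≤ ‖f s - h s‖ + ‖f s - lam s‖ := by
    rw [norm_sub_rev (f s) (h s)]; exact norm_sub_le_norm_sub_add_norm_sub _ _ _
  linarith [hgap s hsm]

lemma injOn (hγ : IsTrace lam γ) (hlam : Continuous lam)
    (hd : ∀ t < 1, ∃ M, 1 ≤ M ∧ LeftDerivBound lam t M) : InjOn γ (Ico 0 1) := by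
  have key : ∀ s ∈ Ico (0:ℝ) 1, ∀ t ∈ Ico (0:ℝ) 1, s < t → γ s ≠ γ t := fun s hs t ht hst e =>
    hγ.not_survives hlam hd hs le_rfl (e ▸ hγ.survives hlam hd hs.1 hst ht.2)
  intro s hs t ht e
  rcases lt_trichotomy s t with h | h | h
  · exact absurd e (key s hs t ht h)
  · exact h
  · exact absurd e.symm (key t ht s hs h)

/-- Swallowed points are close to the trace. -/
lemma exists_dist_le (hγ : IsTrace lam γ) (hlam : Continuous lam) (ht : t ∈ Ico (0:ℝ) 1)
    (hM : 1 ≤ M) (hd : LeftDerivBound lam t M) {z : ℂ} (hz : 0 ≤ z.im)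
    (hns : ¬ Survives lam t z) {ε : ℝ} (hε : 0 < ε) (hεM : ε ≤ 1 / (8 * M))
    (hεz : ε < ‖z - lam 0‖) : ∃ τ ∈ Icc 0 t, ‖z - γ τ‖ ≤ Real.exp (32 * M ^ 2) * ε := by
  obtain ⟨f, hf0, hf⟩ := exists_truncField_solution hlam hε (left_mem_Icc.2 ht.1) z
  have hfc : ContinuousOn (fun s => ‖f s - lam s‖) (Icc 0 t) :=
    (ContinuousOn.sub (fun s hs => (hf s hs).continuousWithinAt)
      (Complex.continuous_ofReal.comp hlam).continuousOn).norm
  obtain ⟨s₀, hs₀, hs₀'⟩ : ∃ s ∈ Icc 0 t, ‖f s - lam s‖ < ε := by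
    by_contra! hcon
    exact hns (survives_iff.2 ⟨f, hf0, IsLoewnerSol.of_truncField hε hf hcon⟩)
  have hcomp : IsCompact (Icc 0 t ∩ (fun s => ‖f s - lam s‖) ⁻¹' Iic ε) :=
    isCompact_Icc.of_isClosed_subset (hfc.preimage_isClosed_of_isClosed isClosed_Icc isClosed_Iic)
      inter_subset_left
  obtain ⟨τ, ⟨hτ, hτε⟩, hmin⟩ := hcomp.exists_isLeast ⟨s₀, hs₀, hs₀'.le⟩
  have hbefore : ∀ s ∈ Ico 0 τ, ε < ‖f s - lam s‖ := fun s hs => by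
    by_contra! hcon
    exact hs.2.not_ge (hmin ⟨⟨hs.1, hs.2.le.trans hτ.2⟩, hcon⟩)
  have hτeq : ‖f τ - lam τ‖ = ε := by
    obtain ⟨s, hs, hse⟩ := intermediate_value_Icc' hτ.1 (hfc.mono (Icc_subset_Icc_right hτ.2))
      ⟨hτε, by simpa [hf0] using hεz.le⟩
    rcases hs.2.eq_or_lt with rfl | hlt
    · exact hse
    · exact absurd hse (hbefore s ⟨hs.1, hlt⟩).ne'
  have hτ0 : 0 < τ := hτ.1.lt_of_ne fun e => by
    rw [← e, hf0] at hτeq; exact hεz.ne' hτeq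
  have hsol : IsLoewnerSol lam τ f := IsLoewnerSol.of_truncField hε
    (fun s hs => (hf s ⟨hs.1, hs.2.trans hτ.2⟩).mono (Icc_subset_Icc_right hτ.2))
    fun s hs => hs.2.eq_or_lt.elim (fun e => e ▸ hτeq.ge) fun h => (hbefore s ⟨hs.1, h⟩).le
  have hnsq : ∀ s, ‖f s - lam s‖ ^ 2 = ((f s).re - lam s) ^ 2 + (f s).im ^ 2 := fun s => by
    rw [← Complex.normSq_eq_norm_sq, Complex.normSq_apply]
    simp only [sub_re, ofReal_re, sub_im, ofReal_im, sub_zero]; ring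
  obtain ⟨d, hdM, hdd⟩ := hd τ ⟨hτ0, hτ.2⟩
  have hτm : τ ∈ Ioc 0 τ := ⟨hτ0, le_rfl⟩
  have hder := (hsol.re_sq_deriv hτm hdd).add (hsol.im_sq_deriv hτm)
  have hneg := le_of_tendsto ((hasDerivWithinAt_iff_tendsto_slope' (by simp)).1
    (hder.mono Iio_subset_Iic_self)) (b := 0) (by
      filter_upwards [Ioo_mem_nhdsLT hτ0] with s hs
      rw [slope_def_field]
      refine div_nonpos_of_nonneg_of_nonpos (sub_nonneg.2 ?_) (sub_nonpos.2 hs.2.le)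
      simp only [Pi.add_apply]
      rw [← hnsq, ← hnsq, hτeq]
      gcongr
      exact (hbefore s ⟨hs.1.le, hs.2⟩).le)
  have hN := (hnsq τ).symm
  rw [hτeq] at hN
  set X := (f τ).re - lam τ
  set Y := (f τ).im with hY
  rw [hN] at hneg
  have hX : |X| ≤ ε := abs_le_of_sq_le_sq (by nlinarith [sq_nonneg Y]) hε.le
  have hXd : X * d ≤ 1 / 8 := by
    calc X * d ≤ |X| * |d| := by rw [← abs_mul]; exact le_abs_self _
      _ ≤ 1 / (8 * M) * M := by gcongr; exact hX.trans hεM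
      _ = 1 / 8 := by field_simp
  have h1 : X ^ 2 - Y ^ 2 ≤ ε ^ 2 / 16 := by
    have e : 4 * X ^ 2 / ε ^ 2 - 2 * X * d + -4 * Y ^ 2 / ε ^ 2 =
      4 * (X ^ 2 - Y ^ 2) / ε ^ 2 - 2 * (X * d) := by ring
    rw [e] at hneg
    have : 4 * (X ^ 2 - Y ^ 2) / ε ^ 2 ≤ 1 / 4 := by linarith
    rw [div_le_iff₀ (by positivity)] at this
    linarith
  have hε2 : 0 < ε ^ 2 := by positivity
  have hY0 : Y ≠ 0 := fun h0 => by
    rw [h0] at h1 hN; linarith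
  have hzpos : 0 < (f 0).im := by
    rw [hf0]
    refine hz.lt_of_ne fun e => hY0 ?_
    exact hsol.im_eq_zero (by rw [hf0, ← e]) ⟨hτ.1, le_rfl⟩
  refine ⟨τ, hτ, ?_⟩
  have := hγ.dist_le hlam ⟨hτ.1, hτ.2.trans_lt ht.2⟩ hM (hd.mono hτ.2) hsol (hX.trans hεM)
    (hsol.im_pos hY0 (left_mem_Icc.2 hτ.1) hzpos (right_mem_Icc.2 hτ.1)) (by nlinarith)
  rwa [hf0, hτeq] at this

lemma loewnerHull_eq (hγ : IsTrace lam γ) (hlam : Continuous lam)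
    (hd : ∀ t < 1, ∃ M, 1 ≤ M ∧ LeftDerivBound lam t M) (ht : t ∈ Ico (0:ℝ) 1) :
    LoewnerHull lam t = γ '' Icc 0 t := by
  refine Subset.antisymm ?_ ?_
  · rintro z ⟨hz, hns⟩
    by_cases hz0 : z = lam 0
    · exact ⟨0, left_mem_Icc.2 ht.1, by rw [hγ.apply_zero hlam hd, hz0]⟩
    obtain ⟨M, hM, hdM⟩ := hd t ht.2
    have hcomp : IsCompact (γ '' Icc 0 t) := isCompact_Icc.image_of_continuousOn
      ((hγ.continuousOn hlam hd).mono fun s hs => ⟨hs.1, hs.2.trans_lt ht.2⟩)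
    rw [← hcomp.isClosed.closure_eq, Metric.mem_closure_iff]
    intro δ hδ
    set C := Real.exp (32 * M ^ 2)
    have hC : 0 < C := Real.exp_pos _
    have hpos : 0 < min (δ / (2 * C)) (min (1 / (8 * M)) (‖z - lam 0‖ / 2)) :=
      lt_min (by positivity) (lt_min (by positivity)
        (half_pos (norm_pos_iff.2 (sub_ne_zero.2 hz0))))
    obtain ⟨τ, hτ, hdist⟩ := hγ.exists_dist_le hlam ht hM hdM hz hns hpos
      ((min_le_right _ _).trans (min_le_left _ _))
      (((min_le_right _ _).trans (min_le_right _ _)).trans_lt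
        (half_lt_self (norm_pos_iff.2 (sub_ne_zero.2 hz0))))
    refine ⟨γ τ, mem_image_of_mem _ hτ, ?_⟩
    rw [dist_eq_norm]
    calc ‖z - γ τ‖ ≤ C * (δ / (2 * C)) := hdist.trans (by gcongr; exact min_le_left _ _)
      _ = δ / 2 := by field_simp
      _ < δ := half_lt_self hδ
  · rintro _ ⟨s, hs, rfl⟩
    have hs1 := hs.2.trans_lt ht.2
    refine ⟨?_, hγ.not_survives hlam hd ⟨hs.1, hs1⟩ hs.2⟩
    rcases hs.1.eq_or_lt with rfl | h0
    · simp [hγ.apply_zero hlam hd]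
    · exact (hγ.im_pos hlam hd ⟨h0, hs1⟩).le

end IsTrace

/-! ### Backward flow along a steep linear piece of the driver -/

namespace IsLoewnerSol

variable {lam : ℝ → ℝ} {T : ℝ} {g : ℝ → ℂ}

lemma re_sub_deriv (h : IsLoewnerSol lam T g) {s d : ℝ} (hs : s ∈ Ioc 0 T)
    (hd : HasDerivWithinAt lam d (Iic s) s) :
    HasDerivWithinAt (fun s => (g s).re - lam s)
      (2 * ((g s).re - lam s) / (((g s).re - lam s) ^ 2 + (g s).im ^ 2) - d) (Iic s) s :=
  (h.re_deriv hs).sub hd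

/-- Along a linear piece of slope `-V`, the backward flow of a point above the driver leaves the
driver at least as fast as a square root. -/
lemma le_normSq_of_linear (hlam : Continuous lam) {V t₀ y : ℝ} (hV : 0 < V) (ht₀ : 0 ≤ t₀)
    (h : IsLoewnerSol lam T g) (hd : ∀ s ∈ Ioc t₀ T, HasDerivWithinAt lam (-V) (Iic s) s)
    (hy : 0 < y) (e : g T = lam T + y * I) {s : ℝ} (hs : s ∈ Icc t₀ T) :
    y ^ 2 + (T - s) ≤ ((g s).re - lam s) ^ 2 + (g s).im ^ 2 := by
  have hre : (g T).re - lam T = 0 := by rw [e, vertical_re, sub_self]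
  have him : (g T).im = y := by rw [e, vertical_im]
  have hT : 0 ≤ T := ht₀.trans (hs.1.trans hs.2)
  have hY : ∀ r ∈ Icc 0 T, 0 < (g r).im := fun r hr =>
    h.im_pos (him ▸ hy.ne') (right_mem_Icc.2 hT) (him ▸ hy) hr
  have hsub : ∀ {r}, r ∈ Icc t₀ T → Icc r T ⊆ Icc 0 T := fun hr =>
    Icc_subset_Icc_left (ht₀.trans hr.1)
  have hmem : ∀ {r}, r ∈ Icc t₀ T → ∀ x ∈ Ioc r T, x ∈ Ioc 0 T ∧ x ∈ Ioc t₀ T := fun hr x hx =>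
    ⟨⟨(ht₀.trans hr.1).trans_lt hx.1, hx.2⟩, ⟨hr.1.trans_lt hx.1, hx.2⟩⟩
  have hXc := h.re_sub_continuousOn hlam
  have hP : ∀ r ∈ Icc t₀ T, (g r).re - lam r ≤ 0 := by
    intro r hr
    have key := le_of_deriv_left_nonneg (f := fun s => ((g s).re - lam s) * (g s).im) hr.2
      ((hXc.mul h.im_continuousOn).mono (hsub hr))
      (fun x hx => (h.re_sub_deriv (hmem hr x hx).1 (hd x (hmem hr x hx).2)).mul
        (h.im_deriv (hmem hr x hx).1))
      (fun x hx => by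
        have := hY x (Ioc_subset_Icc_self (hmem hr x hx).1)
        have : 0 ≤ V * (g x).im := by positivity
        refine this.trans_eq ?_
        ring)
    simp only [hre, zero_mul] at key
    exact nonpos_of_mul_nonpos_left key (hY r (hsub hr (left_mem_Icc.2 hr.2)))
  have hPV : ∀ r ∈ Icc t₀ T, -((g r).re - lam r) ≤ V * (T - r) := by
    intro r hr
    have key := le_of_deriv_left_nonneg (f := fun s => V * s - ((g s).re - lam s)) hr.2
      (((continuous_const.mul continuous_id).continuousOn.sub hXc).mono
        (Icc_subset_Icc_left (ht₀.trans hr.1)))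
      (fun x hx => ((hasDerivWithinAt_id _ _).const_mul V).sub
        (h.re_sub_deriv (hmem hr x hx).1 (hd x (hmem hr x hx).2)))
      (fun x hx => by
        have h1 := hP x (Ioc_subset_Icc_self (hmem hr x hx).2)
        have h2 := h.normSq_pos (Ioc_subset_Icc_self (hmem hr x hx).1)
        have := div_nonpos_of_nonpos_of_nonneg (mul_nonpos_of_nonneg_of_nonpos zero_le_two h1) h2.le
        linarith)
    rw [hre] at key
    linarith
  have hYP : ∀ r ∈ Icc t₀ T, y ^ 2 + 4 * (T - r) - V ^ 2 * (T - r) ^ 2 ≤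
      (g r).im ^ 2 - ((g r).re - lam r) ^ 2 := by
    intro r hr
    have key := le_of_deriv_left_nonneg
      (f := fun s => V ^ 2 * (T - s) ^ 2 * (-1) + ((g s).re - lam s) ^ 2 - (g s).im ^ 2 - 4 * s)
      hr.2
      ((((by fun_prop : Continuous fun s => V ^ 2 * (T - s) ^ 2 * (-1)).continuousOn.add
        (hXc.pow 2)).sub (h.im_continuousOn.pow 2)).sub
          (by fun_prop : Continuous fun s : ℝ => 4 * s).continuousOn |>.mono
        (Icc_subset_Icc_left (ht₀.trans hr.1)))
      (fun x hx => (((((((hasDerivWithinAt_id x (Iic x)).const_sub T).pow 2).const_mul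
        (V ^ 2)).mul_const (-1)).add
          (h.re_sq_deriv (hmem hr x hx).1 (hd x (hmem hr x hx).2))).sub
            (h.im_sq_deriv (hmem hr x hx).1)).sub ((hasDerivWithinAt_id _ _).const_mul 4))
      (fun x hx => by
        have h1 := hPV x (Ioc_subset_Icc_self (hmem hr x hx).2)
        have h2 := h.normSq_pos (Ioc_subset_Icc_self (hmem hr x hx).1)
        set X := (g x).re - lam x
        set Y := (g x).im
        have h3 : 4 * X ^ 2 / (X ^ 2 + Y ^ 2) - -4 * Y ^ 2 / (X ^ 2 + Y ^ 2) = 4 := by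
          field_simp; ring
        have h4 := mul_le_mul_of_nonneg_left h1 hV.le
        refine le_of_le_of_eq (b := 2 * (V * (V * (T - x)) - V * -X)) (by linarith) ?_
        simp only [Nat.cast_ofNat, id]
        linarith)
    rw [hre, him] at key
    linarith
  have key := le_of_deriv_left_nonneg
    (f := fun s => -(((g s).re - lam s) ^ 2 + (g s).im ^ 2) - s) hs.2
    ((((hXc.pow 2).add (h.im_continuousOn.pow 2)).neg.sub continuous_id.continuousOn).mono
      (Icc_subset_Icc_left (ht₀.trans hs.1)))
    (fun x hx => (((h.re_sq_deriv (hmem hs x hx).1 (hd x (hmem hs x hx).2)).add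
      (h.im_sq_deriv (hmem hs x hx).1)).neg).sub (hasDerivWithinAt_id _ _)) ?_
  · rw [hre, him] at key
    linarith
  · intro x hx
    have hx' := Ioc_subset_Icc_self (hmem hs x hx).2
    have hN := h.normSq_pos (Ioc_subset_Icc_self (hmem hs x hx).1)
    have p1 := hP x hx'
    have p2 := hPV x hx'
    have p3 := hYP x hx'
    set X := (g x).re - lam x
    set Y := (g x).im
    rw [show -(4 * X ^ 2 / (X ^ 2 + Y ^ 2) - 2 * X * -V + -4 * Y ^ 2 / (X ^ 2 + Y ^ 2)) - 1 =
      (4 * (Y ^ 2 - X ^ 2) + 2 * (V * -X) * (X ^ 2 + Y ^ 2) - (X ^ 2 + Y ^ 2)) / (X ^ 2 + Y ^ 2) by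
      field_simp; ring]
    refine div_nonneg ?_ hN.le
    have hw : 0 ≤ V * -X := mul_nonneg hV.le (neg_nonneg.2 p1)
    rcases le_total (V ^ 2 * (T - x)) 1 with hsm | hlg
    · have q1 : X ^ 2 ≤ V ^ 2 * (T - x) ^ 2 := by
        rw [← mul_pow, ← neg_sq]; exact pow_le_pow_left₀ (neg_nonneg.2 p1) p2 2
      have q2 : V ^ 2 * (T - x) ^ 2 ≤ T - x := by nlinarith [hx.2]
      nlinarith [mul_nonneg hw hN.le, sq_nonneg y]
    · have hσ : 1 / V ^ 2 ≤ T - x := by rw [div_le_iff₀' (by positivity)]; exact hlg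
      have hσ0 : 0 < 1 / V ^ 2 := by positivity
      have q1 := hYP (T - 1 / V ^ 2) ⟨by linarith [hx'.1], by linarith⟩
      have q2 := h.im_sq_anti (ht₀.trans hx'.1) (b := T - 1 / V ^ 2) (by linarith) (by linarith)
      have q3 : V ^ 2 * (T - (T - 1 / V ^ 2)) ^ 2 = 1 / V ^ 2 := by field_simp; ring
      have q4 : 3 * (1 / V ^ 2) ≤ Y ^ 2 := by
        nlinarith [sq_nonneg ((g (T - 1 / V ^ 2)).re - lam (T - 1 / V ^ 2)), sq_nonneg y]
      have q5 : 3 ≤ (V * Y) ^ 2 := by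
        rw [mul_pow]
        calc (3:ℝ) = V ^ 2 * (3 * (1 / V ^ 2)) := by field_simp
          _ ≤ _ := by gcongr
      refine nonneg_of_mul_nonneg_right (a := V ^ 2) ?_ (by positivity)
      set w := V * -X with hw_def
      have : V ^ 2 * (4 * (Y ^ 2 - X ^ 2) + 2 * w * (X ^ 2 + Y ^ 2) - (X ^ 2 + Y ^ 2)) =
          (3 + 2 * w) * (V * Y) ^ 2 + w * w * (2 * w - 5) := by rw [hw_def]; ring
      rw [this]
      nlinarith [mul_nonneg hw (sq_nonneg (4 * w - 5)), mul_le_mul_of_nonneg_left q5 hw]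

lemma norm_sub_le_of_linear (hlam : Continuous lam) {V t₀ y : ℝ} (hV : 0 < V) (ht₀ : 0 ≤ t₀)
    (hT : t₀ ≤ T) (h : IsLoewnerSol lam T g)
    (hd : ∀ s ∈ Ioc t₀ T, HasDerivWithinAt lam (-V) (Iic s) s)
    (hy : 0 < y) (e : g T = lam T + y * I) : ‖g t₀ - g T‖ ≤ 4 * √(y ^ 2 + (T - t₀)) := by
  have hpos : ∀ x, 0 ≤ x → 0 < y ^ 2 + x := fun x hx => by positivity
  have key := image_norm_le_of_norm_deriv_right_le_deriv_boundary'
    (f := fun s => g (T - s) - g T) (f' := fun s => -(2 / (g (T - s) - lam (T - s))))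
    (B := fun s => 4 * √(y ^ 2 + s)) (B' := fun s => 4 * (1 / (2 * √(y ^ 2 + s))))
    (a := 0) (b := T - t₀) ?_ ?_ (by simp) (by fun_prop) ?_ ?_ (x := T - t₀)
    ⟨sub_nonneg.2 hT, le_rfl⟩
  · simpa using key
  · refine (h.continuousOn.comp (by fun_prop) fun s hs => ?_).sub continuousOn_const
    exact ⟨by linarith [hs.2], by linarith [hs.1]⟩
  · intro x hx
    have := (h.hasDerivWithinAt_Iic (s := T - x) ⟨by linarith [hx.2], by linarith [hx.1]⟩).scomp x
      ((hasDerivAt_id x).const_sub T).hasDerivWithinAt (s := Ici x)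
      (fun y hy => by simp only [mem_Iic, mem_Ici] at *; linarith)
    simpa using! this.sub_const (g T)
  · intro x hx
    have := (((hasDerivAt_id x).const_add (y ^ 2)).sqrt (hpos x hx.1).ne').const_mul 4
    simpa using! this.hasDerivWithinAt
  · intro x hx
    have h1 := h.le_normSq_of_linear hlam hV ht₀ hd hy e (s := T - x)
      ⟨by linarith [hx.2], by linarith [hx.1]⟩
    have h2 : √(y ^ 2 + x) ≤ ‖g (T - x) - lam (T - x)‖ := by
      refine Real.sqrt_le_iff.2 ⟨norm_nonneg _, ?_⟩
      rw [← Complex.normSq_eq_norm_sq, Complex.normSq_apply]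
      simp only [sub_re, ofReal_re, sub_im, ofReal_im, sub_zero]
      linarith
    have h3 : 0 < √(y ^ 2 + x) := Real.sqrt_pos.2 (hpos x hx.1)
    rw [norm_neg, norm_div, Complex.norm_ofNat, show 4 * (1 / (2 * √(y ^ 2 + x))) =
      2 / √(y ^ 2 + x) by field_simp; norm_num]
    gcongr

end IsLoewnerSol

/-! ### Staircase drivers -/

/-- The time at which the `n`-th stage of the staircase starts. -/
def stageTime (q : ℝ) (n : ℕ) : ℝ := 1 - q ^ n

/-- The height of the staircase at the start of the `n`-th stage. -/
def stageHeight (n : ℕ) : ℝ := 16 * (1 / 2) ^ n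

/-- The driver which, during the `n`-th stage, descends from `stageHeight n` to
`stageHeight (n + 1)` with speed `V n` and then waits for the next stage. -/
def staircase (q : ℝ) (V : ℕ → ℝ) (t : ℝ) : ℝ :=
  16 - ∑' n, min (stageHeight (n + 1)) (V n * max (t - stageTime q n) 0)

/-- The ramps of the staircase are so steep that each is short compared with its stage and with the
distortion accumulated before it. -/
structure IsSteep (q : ℝ) (V : ℕ → ℝ) : Prop where
  pos : 0 < q
  le_quarter : q ≤ 1 / 4
  one_le : ∀ n, 1 ≤ V n
  le_succ : ∀ n, V n ≤ V (n + 1)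
  ramp_le : ∀ n, stageHeight (n + 1) ≤ V n * (stageTime q (n + 1) - stageTime q n)
  lt_mul : ∀ n, 128 < V n * stageHeight (n + 1)
  distortion_le : ∀ n, 16 / √(V (n + 1)) * Real.exp (24 * V n ^ 2) ≤
    min (1 / (2 * V n)) (1 / ((n : ℝ) + 1))

lemma stageHeight_pos (n : ℕ) : 0 < stageHeight n := by unfold stageHeight; positivity

lemma stageHeight_succ (n : ℕ) : stageHeight (n + 1) = stageHeight n / 2 := by
  unfold stageHeight; ring

lemma stageHeight_zero : stageHeight 0 = 16 := by simp [stageHeight]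

lemma hasSum_stageHeight_succ : HasSum (fun n => stageHeight (n + 1)) 16 := by
  have e : (fun n => stageHeight (n + 1)) = fun n : ℕ => 8 * (1 / 2 : ℝ) ^ n := by
    funext n
    unfold stageHeight; ring
  rw [e, show (16:ℝ) = 8 * 2 by norm_num]
  exact hasSum_geometric_two.mul_left 8

lemma sum_stageHeight_succ (n : ℕ) :
    ∑ k ∈ Finset.range n, stageHeight (k + 1) = 16 - stageHeight n := by
  induction n with
  | zero => simp [stageHeight]
  | succ n ih => rw [Finset.sum_range_succ, ih, stageHeight_succ n]; ring

lemma exists_steep_sequence {Q : ℕ → ℝ → Prop} {R : ℕ → ℝ → ℝ → Prop}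
    (hQ : ∀ n, ∀ᶠ w in atTop, Q n w) (hR : ∀ n v, ∀ᶠ w in atTop, R n v w) :
    ∃ V : ℕ → ℝ, ∀ n, Q n (V n) ∧ R n (V n) (V (n + 1)) := by
  obtain ⟨v₀, h₀⟩ := (hQ 0).exists
  choose F hF using fun n v => ((hQ (n + 1)).and (hR n v)).exists
  refine ⟨fun n => Nat.rec v₀ F n, fun n => ⟨?_, (hF n _).2⟩⟩
  cases n with
  | zero => exact h₀
  | succ n => exact (hF n _).1

lemma exists_isSteep {q : ℝ} (hq : 0 < q) (hq' : q ≤ 1 / 4) : ∃ V, IsSteep q V := by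
  have hstage : ∀ n, 0 < stageTime q (n + 1) - stageTime q n := fun n => by
    unfold stageTime
    have : q ^ (n + 1) < q ^ n := pow_lt_pow_right_of_lt_one₀ hq (by linarith) n.lt_succ_self
    linarith
  have hdist : ∀ (n : ℕ) (v : ℝ), ∀ᶠ w in atTop, 0 < v →
      16 / √w * Real.exp (24 * v ^ 2) ≤ min (1 / (2 * v)) (1 / ((n : ℝ) + 1)) := by
    intro n v
    by_cases hv : 0 < v
    · have h0 : Tendsto (fun w => 16 / √w * Real.exp (24 * v ^ 2)) atTop (nhds 0) := by
        simpa using (tendsto_const_nhds.div_atTop Real.tendsto_sqrt_atTop).mul_const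
          (Real.exp (24 * v ^ 2))
      filter_upwards [h0.eventually_le_const
        (show 0 < min (1 / (2 * v)) (1 / ((n : ℝ) + 1)) by positivity)] with w hw _ using hw
    · exact .of_forall fun w h => absurd h hv
  obtain ⟨V, hV⟩ := exists_steep_sequence
    (Q := fun n w => 1 ≤ w ∧ stageHeight (n + 1) ≤ w * (stageTime q (n + 1) - stageTime q n) ∧
      128 < w * stageHeight (n + 1))
    (R := fun n v w => v ≤ w ∧ (0 < v → 16 / √w * Real.exp (24 * v ^ 2) ≤
      min (1 / (2 * v)) (1 / ((n : ℝ) + 1))))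
    (fun n => (eventually_ge_atTop 1).and
      (((tendsto_id.atTop_mul_const (hstage n)).eventually_ge_atTop _).and
        ((tendsto_id.atTop_mul_const (stageHeight_pos (n + 1))).eventually_gt_atTop _)))
    (fun n v => (eventually_ge_atTop v).and (hdist n v))
  exact ⟨V, hq, hq', fun n => (hV n).1.1, fun n => (hV n).2.1, fun n => (hV n).1.2.1,
    fun n => (hV n).1.2.2, fun n => (hV n).2.2 (one_pos.trans_le (hV n).1.1)⟩

namespace IsSteep

variable {q : ℝ} {V : ℕ → ℝ} {n : ℕ} {s t : ℝ}

lemma V_pos (h : IsSteep q V) (n : ℕ) : 0 < V n := one_pos.trans_le (h.one_le n)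

lemma lt_one (h : IsSteep q V) : q < 1 := h.le_quarter.trans_lt (by norm_num)

lemma monotone_stageTime (h : IsSteep q V) : Monotone (stageTime q) := fun _ _ hmn =>
  sub_le_sub_left (pow_le_pow_of_le_one h.pos.le h.lt_one.le hmn) _

lemma stageTime_nonneg (h : IsSteep q V) (n : ℕ) : 0 ≤ stageTime q n :=
  sub_nonneg.2 (pow_le_one₀ h.pos.le h.lt_one.le)

lemma stageTime_lt_one (h : IsSteep q V) (n : ℕ) : stageTime q n < 1 :=
  sub_lt_self _ (pow_pos h.pos n)

lemma exists_stage (h : IsSteep q V) (ht : 0 ≤ t) (ht' : t < 1) :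
    ∃ n, stageTime q n ≤ t ∧ t < stageTime q (n + 1) := by
  obtain ⟨n, h1, h2⟩ := exists_nat_pow_near_of_lt_one (sub_pos.2 ht') (sub_le_self 1 ht) h.pos
    h.lt_one
  exact ⟨n, by unfold stageTime; linarith, by unfold stageTime; linarith⟩

lemma exists_stage_left (h : IsSteep q V) (ht : 0 < t) (ht' : t < 1) :
    ∃ n, stageTime q n < t ∧ t ≤ stageTime q (n + 1) := by
  obtain ⟨n, h1, h2⟩ := h.exists_stage ht.le ht'
  rcases h1.lt_or_eq with h1 | h1
  · exact ⟨n, h1, h2.le⟩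
  · cases n with
    | zero => simp [stageTime] at h1; linarith
    | succ n =>
      refine ⟨n, ?_, h1.ge⟩
      rw [← h1]
      exact sub_lt_sub_left (pow_lt_pow_right_of_lt_one₀ h.pos h.lt_one n.lt_succ_self) _

lemma term_nonneg (h : IsSteep q V) (n : ℕ) (t : ℝ) :
    0 ≤ min (stageHeight (n + 1)) (V n * max (t - stageTime q n) 0) :=
  le_min (stageHeight_pos _).le (mul_nonneg (h.V_pos n).le (le_max_right _ _))

lemma summable (h : IsSteep q V) (t : ℝ) :
    Summable fun n => min (stageHeight (n + 1)) (V n * max (t - stageTime q n) 0) :=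
  hasSum_stageHeight_succ.summable.of_nonneg_of_le (fun n => h.term_nonneg n t)
    fun _ => min_le_left _ _

lemma continuous_staircase (h : IsSteep q V) : Continuous (staircase q V) := by
  refine continuous_const.sub (continuous_tsum (fun n => by fun_prop)
    hasSum_stageHeight_succ.summable fun n t => ?_)
  rw [Real.norm_of_nonneg (h.term_nonneg n t)]
  exact min_le_left _ _

lemma antitone_staircase (h : IsSteep q V) : Antitone (staircase q V) := fun s t hst => by
  refine sub_le_sub_left ((h.summable s).tsum_le_tsum (fun n => ?_) (h.summable t)) _
  have := (h.V_pos n).le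
  gcongr

lemma term_eq_of_le (h : IsSteep q V) (ht : stageTime q (n + 1) ≤ t) :
    min (stageHeight (n + 1)) (V n * max (t - stageTime q n) 0) = stageHeight (n + 1) := by
  refine min_eq_left ((h.ramp_le n).trans ?_)
  have := (h.V_pos n).le
  gcongr
  exact le_max_of_le_left (by linarith)

lemma staircase_one (h : IsSteep q V) : staircase q V 1 = 0 := by
  rw [staircase, tsum_congr fun n => h.term_eq_of_le (h.stageTime_lt_one _).le,
    hasSum_stageHeight_succ.tsum_eq, sub_self]

lemma staircase_eq (h : IsSteep q V) (ht : stageTime q n ≤ t) (ht' : t ≤ stageTime q (n + 1)) :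
    staircase q V t = stageHeight n - min (stageHeight (n + 1)) (V n * (t - stageTime q n)) := by
  rw [staircase, tsum_eq_sum (s := Finset.range (n + 1)), Finset.sum_range_succ,
    max_eq_left (sub_nonneg.2 ht), Finset.sum_congr rfl fun k hk => h.term_eq_of_le
      ((h.monotone_stageTime (Finset.mem_range.1 hk)).trans ht), sum_stageHeight_succ]
  · ring
  · intro k hk
    rw [Finset.mem_range, not_lt] at hk
    rw [max_eq_right (sub_nonpos.2 (ht'.trans (h.monotone_stageTime hk))), mul_zero,
      min_eq_right (stageHeight_pos _).le]

lemma staircase_eq_ramp (h : IsSteep q V) (ht : stageTime q n ≤ t)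
    (ht' : V n * (t - stageTime q n) ≤ stageHeight (n + 1)) :
    staircase q V t = stageHeight n - V n * (t - stageTime q n) := by
  rw [h.staircase_eq ht, min_eq_right ht']
  have := le_of_mul_le_mul_left (ht'.trans (h.ramp_le n)) (h.V_pos n)
  linarith

lemma staircase_eq_const (h : IsSteep q V) (ht : t ≤ stageTime q (n + 1))
    (ht' : stageHeight (n + 1) ≤ V n * (t - stageTime q n)) :
    staircase q V t = stageHeight (n + 1) := by
  rw [h.staircase_eq _ ht, min_eq_left ht', stageHeight_succ]
  · ring
  · have := pos_of_mul_pos_right ((stageHeight_pos _).trans_le ht') (h.V_pos n).le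
    linarith

lemma staircase_stageTime (h : IsSteep q V) (n : ℕ) :
    staircase q V (stageTime q n) = stageHeight n := by
  rw [h.staircase_eq_ramp le_rfl (by simpa using (stageHeight_pos _).le)]
  simp

lemma ramp_deriv (h : IsSteep q V) (hs : stageTime q n < s)
    (hs' : V n * (s - stageTime q n) ≤ stageHeight (n + 1)) :
    HasDerivWithinAt (staircase q V) (-V n) (Iic s) s := by
  have : HasDerivWithinAt (fun t => stageHeight n - V n * (t - stageTime q n)) (-V n)
      (Iic s) s := by
    simpa using! ((((hasDerivAt_id s).sub_const (stageTime q n)).const_mul (V n)).const_sub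
      (stageHeight n)).hasDerivWithinAt
  refine this.congr_of_eventuallyEq_of_mem ?_ self_mem_Iic
  filter_upwards [Ioc_mem_nhdsLE hs] with t ht
  refine h.staircase_eq_ramp ht.1.le (le_trans ?_ hs')
  have := (h.V_pos n).le
  gcongr
  exact ht.2

lemma const_deriv (h : IsSteep q V) (hs : s ≤ stageTime q (n + 1))
    (hs' : stageHeight (n + 1) < V n * (s - stageTime q n)) :
    HasDerivWithinAt (staircase q V) 0 (Iic s) s := by
  refine (hasDerivWithinAt_const s (Iic s) (stageHeight (n + 1))).congr_of_eventuallyEq_of_mem ?_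
    self_mem_Iic
  have hc : Continuous fun t => V n * (t - stageTime q n) := by fun_prop
  filter_upwards [self_mem_nhdsWithin,
    nhdsWithin_le_nhds (hc.continuousAt.eventually (lt_mem_nhds hs'))]
    with t ht ht'
  exact h.staircase_eq_const (le_trans ht hs) ht'.le

lemma leftDerivBound (h : IsSteep q V) (n : ℕ) :
    LeftDerivBound (staircase q V) (stageTime q (n + 1)) (V n) := by
  intro s hs
  obtain ⟨m, h1, h2⟩ := h.exists_stage_left hs.1 (hs.2.trans_lt (h.stageTime_lt_one _))
  rcases le_or_gt (V m * (s - stageTime q m)) (stageHeight (m + 1)) with h3 | h3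
  · refine ⟨_, ?_, h.ramp_deriv h1 h3⟩
    rw [abs_neg, abs_of_pos (h.V_pos m)]
    refine monotone_nat_of_le_succ h.le_succ ?_
    by_contra! hmn
    exact (h1.trans_le hs.2).not_ge (h.monotone_stageTime hmn)
  · exact ⟨0, by simpa using (h.V_pos n).le, h.const_deriv h2 h3⟩

lemma exists_leftDerivBound (h : IsSteep q V) (t : ℝ) (ht : t < 1) :
    ∃ M, 1 ≤ M ∧ LeftDerivBound (staircase q V) t M := by
  obtain ⟨n, -, hn⟩ := h.exists_stage (le_max_right t 0) (max_lt ht one_pos)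
  exact ⟨V n, h.one_le n, (h.leftDerivBound n).mono ((le_max_left _ _).trans hn.le)⟩

lemma rpow_le_staircase (h : IsSteep q V) {r : ℝ} (hr : 0 < r) (hq : q ^ r ≤ 1 / 2)
    (ht : t ∈ Icc (0:ℝ) 1) : (1 - t) ^ r ≤ staircase q V t := by
  rcases ht.2.eq_or_lt with rfl | ht'
  · rw [h.staircase_one, sub_self, Real.zero_rpow hr.ne']
  obtain ⟨n, h1, h2⟩ := h.exists_stage ht.1 ht'
  calc (1 - t) ^ r ≤ (q ^ n) ^ r := by
        refine Real.rpow_le_rpow (sub_nonneg.2 ht.2) ?_ hr.le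
        unfold stageTime at h1; linarith
    _ = (q ^ r) ^ n := by
        rw [← Real.rpow_natCast, ← Real.rpow_natCast, ← Real.rpow_mul h.pos.le,
          ← Real.rpow_mul h.pos.le, mul_comm]
    _ ≤ (1 / 2) ^ n := by gcongr; exact Real.rpow_nonneg h.pos.le r
    _ ≤ stageHeight (n + 1) := by
        unfold stageHeight
        have : (0:ℝ) < (1 / 2) ^ n := by positivity
        rw [pow_succ]; linarith
    _ = staircase q V (stageTime q (n + 1)) := (h.staircase_stageTime _).symm
    _ ≤ staircase q V t := h.antitone_staircase h2.le

end IsSteep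

/-! ### Real points swallowed at the terminal time -/

namespace IsLoewnerSol

variable {lam : ℝ → ℝ} {T : ℝ} {g : ℝ → ℂ}

lemma gap_continuousOn (hlam : Continuous lam) (h : IsLoewnerSol lam T g) :
    ContinuousOn (fun s => lam s - (g s).re) (Icc 0 T) :=
  hlam.continuousOn.sub h.re_continuousOn

lemma gap_deriv (h : IsLoewnerSol lam T g) (h0 : (g 0).im = 0) {s d : ℝ} (hs : s ∈ Ioc 0 T)
    (hd : HasDerivWithinAt lam d (Iic s) s) :
    HasDerivWithinAt (fun s => lam s - (g s).re) (d + 2 / (lam s - (g s).re)) (Iic s) s := by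
  have hN := h.normSq_pos (Ioc_subset_Icc_self hs)
  refine (hd.sub (h.re_deriv hs)).congr_deriv ?_
  rw [h.im_eq_zero h0 (Ioc_subset_Icc_self hs)] at hN ⊢
  have h1 : (g s).re - lam s ≠ 0 := fun e => by simp [e] at hN
  have h2 : lam s - (g s).re ≠ 0 := fun e => h1 (by linarith)
  field_simp
  ring

lemma norm_sub_of_real (h : IsLoewnerSol lam T g) (h0 : (g 0).im = 0) {s : ℝ} (hs : s ∈ Icc 0 T) :
    ‖g s - lam s‖ = |lam s - (g s).re| := by
  have : g s - lam s = ((g s).re - lam s : ℝ) := by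
    apply Complex.ext <;> simp [h.im_eq_zero h0 hs]
  rw [this, Complex.norm_real, Real.norm_eq_abs, abs_sub_comm]

lemma gap_pos (hlam : Continuous lam) (h : IsLoewnerSol lam T g) (h0 : (g 0).im = 0)
    (hx : (g 0).re < lam 0) {s : ℝ} (hs : s ∈ Icc 0 T) : 0 < lam s - (g s).re := by
  by_contra! hcon
  have : (0 : ℝ) ∈ (fun s => lam s - (g s).re) '' Icc 0 T :=
    (isPreconnected_Icc.image _ (h.gap_continuousOn hlam)).ordConnected.out
      (mem_image_of_mem _ hs) (mem_image_of_mem _ (left_mem_Icc.2 (hs.1.trans hs.2)))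
      ⟨hcon, (sub_pos.2 hx).le⟩
  obtain ⟨r, hr, e⟩ := this
  refine sub_ne_zero.2 (h r hr).1 (norm_eq_zero.1 ?_)
  rw [h.norm_sub_of_real h0 hr, abs_eq_zero]
  exact e

lemma inv_le_gap (hlam : Continuous lam) (h : IsLoewnerSol lam T g) (h0 : (g 0).im = 0)
    (hx : 1 ≤ lam 0 - (g 0).re) {V : ℝ} (hV : 1 ≤ V) (hd : LeftDerivBound lam T V) {s : ℝ}
    (hs : s ∈ Icc 0 T) : 1 / V ≤ lam s - (g s).re := by
  have hV0 : 0 < V := one_pos.trans_le hV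
  have hpos := h.gap_pos hlam h0 (by linarith) hs
  by_contra! hcon
  choose! d hdV hd' using hd
  have key := fence_left (f := fun s => lam s - (g s).re) (B := fun _ => lam s - (g s).re)
    (B' := fun _ => 0) hs.1 ((h.gap_continuousOn hlam).mono (Icc_subset_Icc_right hs.2))
    (fun x hx => h.gap_deriv h0 ⟨hx.1, hx.2.trans hs.2⟩ (hd' x ⟨hx.1, hx.2.trans hs.2⟩))
    (fun x => hasDerivAt_const _ _) le_rfl fun x hx e => ?_
  · have : 1 / V ≤ 1 := (div_le_one hV0).2 hV
    linarith
  · have h1 := (abs_le.1 (hdV x ⟨hx.1, hx.2.trans hs.2⟩)).1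
    have h2 : V < 1 / (lam s - (g s).re) := (lt_one_div hpos hV0).1 hcon
    rw [e]
    have h3 : 2 / (lam s - (g s).re) = 2 * (1 / (lam s - (g s).re)) := by ring
    linarith

end IsLoewnerSol

namespace IsSteep

variable {q : ℝ} {V : ℕ → ℝ} {g : ℝ → ℂ}

lemma stageTime_succ_sub_le (h : IsSteep q V) (n : ℕ) :
    stageTime q (n + 1) - stageTime q n ≤ (1 / 4) ^ n := by
  have h1 : q ^ n ≤ (1 / 4) ^ n := pow_le_pow_left₀ h.pos.le h.le_quarter n
  have h2 : 0 < q ^ (n + 1) := pow_pos h.pos _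
  unfold stageTime
  linarith

lemma staircase_zero (h : IsSteep q V) : staircase q V 0 = 16 := by
  simpa [stageTime, stageHeight_zero] using h.staircase_stageTime 0

/-- A real point closer to the driver than the length of the next ramp is overtaken neither on that
ramp nor during the following wait. -/
lemma gap_succ_lt (h : IsSteep q V) {n : ℕ}
    (hg : IsLoewnerSol (staircase q V) (stageTime q (n + 1)) g) (h0 : (g 0).im = 0)
    (hx : (g 0).re < staircase q V 0)
    (hn : staircase q V (stageTime q n) - (g (stageTime q n)).re < stageHeight (n + 1)) :
    staircase q V (stageTime q (n + 1)) - (g (stageTime q (n + 1))).re < stageHeight (n + 2) := by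
  have hη := stageHeight_pos (n + 1)
  have hV := h.V_pos n
  have hlam := h.continuous_staircase
  obtain ⟨e, he⟩ : ∃ e, e = stageTime q n + stageHeight (n + 1) / V n := ⟨_, rfl⟩
  have heV : V n * (e - stageTime q n) = stageHeight (n + 1) := by rw [he]; field_simp; ring
  have hne : stageTime q n < e := by rw [he]; linarith [div_pos hη hV]
  have hen : e ≤ stageTime q (n + 1) := by
    have := le_of_mul_le_mul_left (heV.trans_le (h.ramp_le n)) hV
    linarith
  have hn0 := h.stageTime_nonneg n
  have hramp : staircase q V e - (g e).re < stageHeight (n + 1) / 8 := by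
    by_contra! hcon
    have key := fence_left (f := fun s => -(staircase q V s - (g s).re))
      (B := fun s => 7 / 8 * V n * (s - e) - stageHeight (n + 1) / 8) (B' := fun _ => 7 / 8 * V n)
      hne.le (((hg.gap_continuousOn hlam).mono (Icc_subset_Icc hn0 hen)).neg)
      (fun s hs => (hg.gap_deriv h0 ⟨hn0.trans_lt hs.1, hs.2.trans hen⟩
        (h.ramp_deriv hs.1 (heV ▸ by gcongr; exact hs.2))).neg)
      (fun s => by
        simpa using! (((hasDerivAt_id s).sub_const e).const_mul (7 / 8 * V n)).sub_const
          (stageHeight (n + 1) / 8))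
      (by rw [sub_self, mul_zero, zero_sub]; exact neg_le_neg hcon) fun s hs hsB => ?_
    · linarith
    · have h1 : stageHeight (n + 1) / 8 ≤ staircase q V s - (g s).re := by
        nlinarith [mul_nonneg hV.le (sub_nonneg.2 hs.2)]
      have h2 : 2 / (staircase q V s - (g s).re) ≤ 2 / (stageHeight (n + 1) / 8) := by gcongr
      have h3 : 2 / (stageHeight (n + 1) / 8) < V n / 8 := by
        rw [div_lt_iff₀ (by positivity)]
        linarith [h.lt_mul n]
      linarith
  have hwait := le_of_deriv_left_nonneg
    (f := fun s => 4 * s - (staircase q V s - (g s).re) ^ 2) (a := e) hen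
    ((by fun_prop : Continuous fun s : ℝ => 4 * s).continuousOn.sub
      (((hg.gap_continuousOn hlam).mono (Icc_subset_Icc_left (hn0.trans hne.le))).pow 2))
    (fun s hs => ((hasDerivWithinAt_id s _).const_mul 4).sub ((hg.gap_deriv h0
      ⟨(hn0.trans_lt hne).trans hs.1, hs.2⟩ (h.const_deriv hs.2 (heV ▸ by
        gcongr; exact hs.1))).pow 2))
    (fun s hs => by
      have := hg.gap_pos hlam h0 hx ⟨(hn0.trans_lt hne).le.trans hs.1.le, hs.2⟩
      refine le_of_eq ?_
      simp only [Nat.cast_ofNat]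
      field_simp
      ring)
  have he0 := hg.gap_pos hlam h0 hx ⟨(hn0.trans_lt hne).le, hen⟩
  have h1 := h.stageTime_succ_sub_le n
  have h2 : (staircase q V e - (g e).re) ^ 2 < (stageHeight (n + 1) / 8) ^ 2 :=
    pow_lt_pow_left₀ hramp he0.le two_ne_zero
  have h3 : stageHeight (n + 1) ^ 2 = 64 * (1 / 4) ^ n := by
    unfold stageHeight
    rw [show (1 / 4 : ℝ) ^ n = ((1 / 2) ^ n) ^ 2 by rw [← pow_mul, mul_comm, pow_mul]; norm_num]
    ring
  refine lt_of_pow_lt_pow_left₀ 2 (stageHeight_pos _).le ?_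
  rw [stageHeight_succ (n + 1)]
  have h4 : (0:ℝ) < (1 / 4) ^ n := by positivity
  nlinarith

lemma gap_lt (h : IsSteep q V) (n : ℕ) (hg : IsLoewnerSol (staircase q V) (stageTime q n) g)
    (h0 : (g 0).im = 0) (hx : (g 0).re ∈ Ioo 8 16) :
    staircase q V (stageTime q n) - (g (stageTime q n)).re < stageHeight (n + 1) := by
  induction n with
  | zero =>
    have : stageTime q 0 = 0 := by simp [stageTime]
    rw [this, h.staircase_zero, stageHeight_succ, stageHeight_zero]
    linarith [hx.1]
  | succ n ih =>
    exact h.gap_succ_lt hg h0 (h.staircase_zero ▸ hx.2)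
      (ih (hg.mono (h.monotone_stageTime n.le_succ)))

end IsSteep

/-! ### Oscillation of the trace -/

namespace IsSteep

variable {q : ℝ} {V : ℕ → ℝ} {γ : ℝ → ℂ}

/-- When the driver crosses the current image of a real point `x`, the tip of the trace is close
to `x`. -/
lemma exists_norm_trace_sub_le (h : IsSteep q V) (hγ : IsTrace (staircase q V) γ) {x : ℝ}
    (hx : x ∈ Icc 9 15) (m : ℕ) :
    ∃ τ ∈ Ico (stageTime q (m + 1)) 1, ‖γ τ - x‖ ≤ 2 / ((m : ℝ) + 1) := by
  have hlam := h.continuous_staircase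
  have ht0 := h.stageTime_nonneg (m + 1)
  have ht1 := h.stageTime_lt_one (m + 1)
  have hV := h.V_pos m
  have hV' := h.V_pos (m + 1)
  obtain ⟨g₀, hg₀, hsol₀⟩ : ∃ g : ℝ → ℂ, g 0 = x ∧
      IsLoewnerSol (staircase q V) (stageTime q (m + 1)) g := by
    rw [← survives_iff]
    by_contra hcon
    have hmem : (x : ℂ) ∈ LoewnerHull (staircase q V) (stageTime q (m + 1)) :=
      ⟨by simp, hcon⟩
    rw [hγ.loewnerHull_eq hlam h.exists_leftDerivBound ⟨ht0, ht1⟩] at hmem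
    obtain ⟨s, hs, e⟩ := hmem
    rcases hs.1.eq_or_lt with rfl | hs0
    · rw [hγ.apply_zero hlam h.exists_leftDerivBound, h.staircase_zero, ofReal_inj] at e
      linarith [hx.2]
    · have := hγ.im_pos hlam h.exists_leftDerivBound ⟨hs0, hs.2.trans_lt ht1⟩
      rw [e, ofReal_im] at this
      exact lt_irrefl _ this
  have him : (g₀ 0).im = 0 := by rw [hg₀, ofReal_im]
  have hre : (g₀ 0).re = x := by rw [hg₀, ofReal_re]
  have hgap : ∀ s ∈ Icc 0 (stageTime q (m + 1)), 1 / V m ≤ ‖g₀ s - staircase q V s‖ := by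
    intro s hs
    rw [hsol₀.norm_sub_of_real him hs]
    refine (hsol₀.inv_le_gap hlam him ?_ (h.one_le m) (h.leftDerivBound m) hs).trans (le_abs_self _)
    rw [h.staircase_zero, hre]
    linarith [hx.2]
  have hlt := h.gap_lt (m + 1) hsol₀ him
    (by rw [hre]; exact ⟨by linarith [hx.1], by linarith [hx.2]⟩)
  have hpos := hsol₀.gap_pos hlam him (by rw [hre, h.staircase_zero]; linarith [hx.2])
    (right_mem_Icc.2 ht0)
  have hreal : g₀ (stageTime q (m + 1)) = ((g₀ (stageTime q (m + 1))).re : ℂ) := by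
    apply Complex.ext <;> simp [hsol₀.im_eq_zero him (right_mem_Icc.2 ht0)]
  rw [h.staircase_stageTime] at hlt hpos
  obtain ⟨y, hy⟩ : ∃ y, y = (g₀ (stageTime q (m + 1))).re := ⟨_, rfl⟩
  rw [← hy] at hlt hpos hreal
  obtain ⟨τ, hτ⟩ : ∃ τ, τ = stageTime q (m + 1) + (stageHeight (m + 1) - y) / V (m + 1) := ⟨_, rfl⟩
  have hVτ : V (m + 1) * (τ - stageTime q (m + 1)) = stageHeight (m + 1) - y := by
    rw [hτ]; field_simp; ring
  have hτt : stageTime q (m + 1) < τ := by rw [hτ]; linarith [div_pos hpos hV']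
  have hτt' : τ ≤ stageTime q (m + 2) := by
    have := le_of_mul_le_mul_left (hVτ.trans_le (hlt.le.trans (h.ramp_le (m + 1)))) hV'
    linarith
  have hτ1 : τ < 1 := hτt'.trans_lt (h.stageTime_lt_one _)
  have hτ0 : 0 ≤ τ := ht0.trans hτt.le
  have hlamτ : staircase q V τ = y := by
    rw [h.staircase_eq_ramp hτt.le (hVτ ▸ hlt.le), hVτ]; ring
  have hτV : τ - stageTime q (m + 1) ≤ 8 / V (m + 1) := by
    rw [le_div_iff₀' hV', hVτ]
    have : stageHeight (m + 2) ≤ 4 := by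
      have h1 : (1 / 2 : ℝ) ^ (m + 2) ≤ (1 / 2) ^ 2 :=
        pow_le_pow_of_le_one (by norm_num) (by norm_num) (by lia)
      unfold stageHeight
      linarith
    linarith
  refine ⟨τ, ⟨hτt.le, hτ1⟩, ?_⟩
  have hsq : 0 < √(V (m + 1)) := Real.sqrt_pos.2 hV'
  obtain ⟨p, hp⟩ : ∃ p, p = min (1 / √(V (m + 1)))
    ((Real.exp (32 * V (m + 1) ^ 2))⁻¹ * (1 / ((m : ℝ) + 1))) := ⟨_, rfl⟩
  have hp0 : 0 < p := by rw [hp]; positivity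
  have hpV : p ≤ 1 / √(V (m + 1)) := hp ▸ min_le_left _ _
  have hpe : Real.exp (32 * V (m + 1) ^ 2) * p ≤ 1 / ((m : ℝ) + 1) := by
    rw [← le_inv_mul_iff₀ (Real.exp_pos _), hp]
    exact min_le_right _ _
  obtain ⟨g, hgτ, hsol⟩ := exists_vertical_solution hlam hτ0 hp0
  have htrace := hγ τ ⟨hτ0, hτ1⟩ _ (h.one_le (m + 1)) ((h.leftDerivBound (m + 1)).mono hτt') p hp0
    g hgτ hsol
  have hback := hsol.norm_sub_le_of_linear hlam hV' ht0 hτt.le (fun s hs => h.ramp_deriv hs.1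
    (le_trans (by gcongr; exact hs.2) (hVτ ▸ hlt.le))) hp0 hgτ
  have hdist : ‖g (stageTime q (m + 1)) - g₀ (stageTime q (m + 1))‖ ≤ 16 / √(V (m + 1)) := by
    have h1 : √(p ^ 2 + (τ - stageTime q (m + 1))) ≤ 3 / √(V (m + 1)) := by
      refine Real.sqrt_le_iff.2 ⟨by positivity, ?_⟩
      have h2 : p ^ 2 ≤ (1 / √(V (m + 1))) ^ 2 := by gcongr
      rw [div_pow, Real.sq_sqrt hV'.le] at h2 ⊢
      calc _ ≤ 1 ^ 2 / V (m + 1) + 8 / V (m + 1) := add_le_add h2 hτV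
        _ = _ := by ring
    have h2 : ‖g τ - g₀ (stageTime q (m + 1))‖ = p := by
      rw [hgτ, hreal, hlamτ, add_sub_cancel_left, norm_mul, norm_I, mul_one, Complex.norm_real,
        Real.norm_of_nonneg hp0.le]
    calc _ ≤ ‖g (stageTime q (m + 1)) - g τ‖ + ‖g τ - g₀ (stageTime q (m + 1))‖ :=
          norm_sub_le_norm_sub_add_norm_sub _ _ _
      _ ≤ 4 * (3 / √(V (m + 1))) + 1 / √(V (m + 1)) := by
          rw [h2]; exact add_le_add (hback.trans (by gcongr)) hpV
      _ = 13 / √(V (m + 1)) := by ring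
      _ ≤ _ := by gcongr; norm_num
  have hexp : ‖g (stageTime q (m + 1)) - g₀ (stageTime q (m + 1))‖ *
      Real.exp (24 / (1 / V m) ^ 2 * stageTime q (m + 1)) ≤
        min (1 / (2 * V m)) (1 / ((m : ℝ) + 1)) := by
    refine le_trans ?_ (h.distortion_le m)
    refine mul_le_mul hdist (Real.exp_le_exp.2 ?_) (Real.exp_pos _).le (by positivity)
    rw [one_div, inv_pow, div_inv_eq_mul]
    exact mul_le_of_le_one_right (by positivity) ht1.le
  obtain ⟨g', hg't, hsol', hclose⟩ := hsol₀.stability hlam (one_div_pos.2 hV) hgap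
    (right_mem_Icc.2 ht0) (hexp.trans ((min_le_left _ _).trans_eq (by field_simp)))
  have hg0 : g 0 = g' 0 := (hsol.mono hτt.le).unique hlam hsol' (right_mem_Icc.2 ht0)
    (left_mem_Icc.2 ht0) hg't.symm
  have hnear : ‖g 0 - x‖ ≤ 1 / ((m : ℝ) + 1) := by
    rw [hg0, ← hg₀]
    exact (hclose 0 (left_mem_Icc.2 ht0)).trans (hexp.trans (min_le_right _ _))
  calc ‖γ τ - x‖ ≤ ‖γ τ - g 0‖ + ‖g 0 - x‖ := norm_sub_le_norm_sub_add_norm_sub _ _ _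
    _ ≤ 1 / ((m : ℝ) + 1) + 1 / ((m : ℝ) + 1) := by
        rw [norm_sub_rev (γ τ)]
        exact add_le_add (htrace.trans hpe) hnear
    _ = _ := by ring

lemma mapClusterPt_trace (h : IsSteep q V) (hγ : IsTrace (staircase q V) γ) {x : ℝ}
    (hx : x ∈ Icc 9 15) : MapClusterPt (x : ℂ) (nhdsWithin 1 (Iio 1)) γ := by
  choose τ hτ hγτ using h.exists_norm_trace_sub_le hγ hx
  have hstage : Tendsto (fun m => stageTime q (m + 1)) atTop (nhds 1) := by
    have := ((tendsto_pow_atTop_nhds_zero_of_lt_one h.pos.le h.lt_one).comp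
      (tendsto_add_atTop_nat 1)).const_sub 1
    rwa [sub_zero] at this
  have h1 : Tendsto τ atTop (nhdsWithin 1 (Iio 1)) :=
    tendsto_nhdsWithin_iff.2 ⟨tendsto_of_tendsto_of_tendsto_of_le_of_le hstage tendsto_const_nhds
      (fun m => (hτ m).1) (fun m => (hτ m).2.le), .of_forall fun m => (hτ m).2⟩
  have h2 : Tendsto (γ ∘ τ) atTop (nhds (x : ℂ)) := by
    rw [tendsto_iff_norm_sub_tendsto_zero]
    refine squeeze_zero (fun _ => norm_nonneg _) hγτ ?_
    have := (tendsto_one_div_add_atTop_nhds_zero_nat (𝕜 := ℝ)).const_mul 2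
    simpa only [mul_one_div, mul_zero] using this
  exact h2.mapClusterPt.of_comp h1

end IsSteep

lemma eq_of_mapClusterPt_of_tendsto {α X : Type*} [TopologicalSpace X] [T2Space X] {l : Filter α}
    {f : α → X} {x y : X} (hx : MapClusterPt x l f) (hy : Tendsto f l (nhds y)) : x = y :=
  eq_of_nhds_neBot (ClusterPt.mono hx hy)

/-- Proposition 4.2: for each `r ∈ (0,1/2)` there is a
continuous monotone driver bounded below by `a(1-t)^r` whose hulls are a
simple curve on `[0,1)` but whose trace fails to have a limit at time 1;
the cluster set of the trace contains a nondegenerate real interval. -/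
theorem stmt11 (r : ℝ) (hr : r ∈ Ioo (0:ℝ) (1/2)) :
    ∃ a : ℝ, 0 < a ∧ ∃ lam : ℝ → ℝ,
      ContinuousOn lam (Icc 0 1) ∧ AntitoneOn lam (Icc 0 1) ∧ lam 1 = 0 ∧
      (∀ t ∈ Icc (0:ℝ) 1, a * (1 - t) ^ r ≤ lam t) ∧
      ∃ γ : ℝ → ℂ, ContinuousOn γ (Ico 0 1) ∧ InjOn γ (Ico 0 1) ∧
        γ 0 = ((lam 0 : ℝ) : ℂ) ∧ (∀ t ∈ Ioo (0:ℝ) 1, 0 < (γ t).im) ∧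
        (∀ t ∈ Ico (0:ℝ) 1, LoewnerHull lam t = γ '' Icc 0 t) ∧
        (¬ ∃ L : ℂ, Tendsto γ (nhdsWithin 1 (Iio 1)) (nhds L)) ∧
        ∃ c d : ℝ, c < d ∧ ∀ x ∈ Icc c d,
          MapClusterPt ((x : ℝ) : ℂ) (nhdsWithin 1 (Iio 1)) γ := by
  obtain ⟨q, hq⟩ : ∃ q : ℝ, q = (1 / 2) ^ (1 / r) := ⟨_, rfl⟩
  have hq0 : 0 < q := hq ▸ by positivity
  have hqr : q ^ r = 1 / 2 := by
    rw [hq, ← Real.rpow_mul (by norm_num), one_div_mul_cancel hr.1.ne', Real.rpow_one]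
  have hq4 : q ≤ 1 / 4 := by
    have h2 : (2:ℝ) ≤ 1 / r := by rw [le_div_iff₀ hr.1]; linarith [hr.2]
    calc q ≤ (1 / 2) ^ (2:ℝ) := hq ▸ Real.rpow_le_rpow_of_exponent_ge (by norm_num) (by norm_num) h2
      _ = 1 / 4 := by norm_num
  obtain ⟨V, h⟩ := exists_isSteep hq0 hq4
  have hlam := h.continuous_staircase
  have hd := h.exists_leftDerivBound
  obtain ⟨γ, hγ⟩ := exists_isTrace hlam hd
  refine ⟨1, one_pos, staircase q V, hlam.continuousOn, h.antitone_staircase.antitoneOn _,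
    h.staircase_one, fun t ht => by simpa using h.rpow_le_staircase hr.1 hqr.le ht, γ,
    hγ.continuousOn hlam hd, hγ.injOn hlam hd, hγ.apply_zero hlam hd,
    fun t ht => hγ.im_pos hlam hd ht, fun t ht => hγ.loewnerHull_eq hlam hd ht, ?_,
    9, 15, by norm_num, fun x hx => h.mapClusterPt_trace hγ hx⟩
  rintro ⟨L, hL⟩
  have h9 := eq_of_mapClusterPt_of_tendsto
    (h.mapClusterPt_trace hγ (x := 9) ⟨le_rfl, by norm_num⟩) hL
  have h15 := eq_of_mapClusterPt_of_tendsto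
    (h.mapClusterPt_trace hγ (x := 15) ⟨by norm_num, le_rfl⟩) hL
  have := ofReal_inj.1 (h9.trans h15.symm)
  norm_num at this
end
end

section
/- Let a ≥ 4, r ∈ (0, 1/2), and let λ : [0,1] → ℝ be continuous with λ(1) = 0 and λ(t) ≥ a(1−t)^r for all t ∈ [0,1]. Let K_t denote the Loewner hulls driven by λ and let p = inf { x ∈ ℝ : x ∈ K₁ }. Then for every s ∈ (0,1), the distance from p to the hull K_s satisfies dist(p, K_s) ≥ (1/10)·min_{t ∈ [0,s]} λ(t). -/
open Set Complex Filter

noncomputable section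

/-- The point with the same imaginary part as `h` and real part `max h.re δ`. -/
def clampRe (δ : ℝ) (h : ℂ) : ℂ := h + ((max (δ - h.re) 0 : ℝ) : ℂ)

lemma le_re_clampRe (δ : ℝ) (h : ℂ) : δ ≤ (clampRe δ h).re := by
  have := le_max_left (δ - h.re) 0
  simp only [clampRe, add_re, ofReal_re]
  linarith

lemma clampRe_of_le {δ : ℝ} {h : ℂ} (hh : δ ≤ h.re) : clampRe δ h = h := by
  simp [clampRe, max_eq_right (sub_nonpos.2 hh)]

lemma norm_clampRe_sub_le (δ : ℝ) (h k : ℂ) :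
    ‖clampRe δ h - clampRe δ k‖ ≤ 2 * ‖h - k‖ := by
  have e : clampRe δ h - clampRe δ k
      = (h - k) + ((max (δ - h.re) 0 - max (δ - k.re) 0 : ℝ) : ℂ) := by
    simp only [clampRe, ofReal_sub]
    ring
  have h1 : |max (δ - h.re) 0 - max (δ - k.re) 0| ≤ ‖h - k‖ := by
    refine (abs_max_sub_max_le_abs _ _ _).trans ?_
    have := abs_re_le_norm (k - h)
    rw [norm_sub_rev h k]
    simpa using this
  rw [e]
  refine (norm_add_le _ _).trans ?_
  rw [norm_real, Real.norm_eq_abs]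
  linarith

lemma le_norm_clampRe (δ : ℝ) (h : ℂ) : δ ≤ ‖clampRe δ h‖ :=
  (le_re_clampRe δ h).trans (re_le_norm _)

lemma norm_neg_two_div_clampRe_le {δ : ℝ} (hδ : 0 < δ) (h : ℂ) :
    ‖-2 / clampRe δ h‖ ≤ 2 / δ := by
  rw [norm_div, norm_neg, RCLike.norm_ofNat]
  have := le_norm_clampRe δ h
  gcongr

lemma norm_neg_two_div_clampRe_sub_le {δ : ℝ} (hδ : 0 < δ) (h k : ℂ) :
    ‖-2 / clampRe δ h - -2 / clampRe δ k‖ ≤ 4 / δ ^ 2 * ‖h - k‖ := by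
  have hh := le_norm_clampRe δ h
  have hk := le_norm_clampRe δ k
  have h0 : clampRe δ h ≠ 0 := norm_pos_iff.1 (hδ.trans_le hh)
  have k0 : clampRe δ k ≠ 0 := norm_pos_iff.1 (hδ.trans_le hk)
  have e : -2 / clampRe δ h - -2 / clampRe δ k
      = 2 * (clampRe δ h - clampRe δ k) / (clampRe δ h * clampRe δ k) := by
    field_simp
    ring
  rw [e, norm_div, norm_mul, norm_mul, RCLike.norm_ofNat]
  have h3 := norm_clampRe_sub_le δ h k
  calc 2 * ‖clampRe δ h - clampRe δ k‖ / (‖clampRe δ h‖ * ‖clampRe δ k‖)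
      ≤ 2 * (2 * ‖h - k‖) / (δ * δ) := by gcongr
    _ = 4 / δ ^ 2 * ‖h - k‖ := by ring

/-- Global existence for the Loewner equation with clamped denominator. -/
lemma exists_clamped_solution {lam : ℝ → ℝ} {T δ : ℝ} (hT : 0 ≤ T) (hδ : 0 < δ)
    (hcont : ContinuousOn lam (Icc 0 T)) (z : ℂ) :
    ∃ g : ℝ → ℂ, g 0 = z ∧ ∀ t ∈ Icc (0:ℝ) T,
      HasDerivWithinAt g (-2 / clampRe δ ((lam t : ℂ) - g t)) (Icc 0 T) t := by
  have hL : 0 ≤ 2 / δ := by positivity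
  have hK : 0 ≤ 4 / δ ^ 2 := by positivity
  have hPL : IsPicardLindelof (fun t w => -2 / clampRe δ ((lam t : ℂ) - w))
      (⟨0, le_rfl, hT⟩ : Icc (0:ℝ) T) z (⟨2 / δ * T, mul_nonneg hL hT⟩) 0
      ⟨2 / δ, hL⟩ ⟨4 / δ ^ 2, hK⟩ := by
    refine ⟨fun t _ => ?_, fun w _ => ?_, fun t _ w _ => norm_neg_two_div_clampRe_le hδ _, ?_⟩
    · refine LipschitzOnWith.of_dist_le_mul fun x _ y _ => ?_
      rw [dist_eq_norm, dist_eq_norm]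
      refine (norm_neg_two_div_clampRe_sub_le hδ _ _).trans_eq ?_
      rw [show ((lam t : ℂ) - x) - ((lam t : ℂ) - y) = -(x - y) by ring, norm_neg]
      rfl
    · have hc : Continuous fun h : ℂ => -2 / clampRe δ h := by
        refine continuous_const.div ?_ fun h =>
          norm_pos_iff.1 (hδ.trans_le (le_norm_clampRe δ h))
        unfold clampRe
        fun_prop
      exact hc.comp_continuousOn
        ((continuous_ofReal.comp_continuousOn hcont).sub continuousOn_const)
    · simp only [sub_zero, sub_self, max_eq_left hT, NNReal.coe_zero]
      exact le_rfl
  exact hPL.exists_eq_forall_mem_Icc_hasDerivWithinAt₀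

/-- If every solution of the clamped equation started at `z` stays where clamping has no effect,
then `z` survives. -/
lemma survives_of_clamped {lam : ℝ → ℝ} {T δ : ℝ} (hT : 0 ≤ T) (hδ : 0 < δ)
    (hcont : ContinuousOn lam (Icc 0 T)) {z : ℂ}
    (h : ∀ g : ℝ → ℂ, g 0 = z → (∀ t ∈ Icc (0:ℝ) T,
      HasDerivWithinAt g (-2 / clampRe δ ((lam t : ℂ) - g t)) (Icc 0 T) t) →
      ∀ t ∈ Icc (0:ℝ) T, δ ≤ ((lam t : ℂ) - g t).re) :
    Survives lam T z := by
  obtain ⟨g, hg0, hg⟩ := exists_clamped_solution hT hδ hcont z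
  refine ⟨g, hg0, fun t ht => (hg t ht).continuousWithinAt, fun t ht => ?_⟩
  have hre := h g hg0 hg t ht
  refine ⟨fun e => ?_, ?_⟩
  · rw [e, sub_self, zero_re] at hre
    linarith
  · have := hg t ht
    rwa [clampRe_of_le hre, neg_div, ← div_neg, neg_sub] at this

lemma HasDerivWithinAt.re_comp {g : ℝ → ℂ} {g' : ℂ} {S : Set ℝ} {t : ℝ}
    (h : HasDerivWithinAt g g' S t) : HasDerivWithinAt (fun t => (g t).re) g'.re S t :=
  reCLM.hasFDerivAt.comp_hasDerivWithinAt t h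

lemma HasDerivWithinAt.im_comp {g : ℝ → ℂ} {g' : ℂ} {S : Set ℝ} {t : ℝ}
    (h : HasDerivWithinAt g g' S t) : HasDerivWithinAt (fun t => (g t).im) g'.im S t :=
  imCLM.hasFDerivAt.comp_hasDerivWithinAt t h

lemma HasDerivWithinAt.Ici_of_Icc {f : ℝ → ℝ} {f' a b t : ℝ}
    (h : HasDerivWithinAt f f' (Icc a b) t) (ht : t ∈ Ico a b) :
    HasDerivWithinAt f f' (Ici t) t :=
  h.mono_of_mem_nhdsWithin (Icc_mem_nhdsGE_of_mem ht)

/-- A negative starting point survives when the driving function is nonnegative. -/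
lemma survives_of_neg {lam : ℝ → ℝ} {T : ℝ} (hT : 0 ≤ T)
    (hcont : ContinuousOn lam (Icc 0 T)) (hlam : ∀ t ∈ Icc (0:ℝ) T, 0 ≤ lam t)
    {x : ℝ} (hx : x < 0) : Survives lam T (x : ℂ) := by
  refine survives_of_clamped (δ := -x) hT (neg_pos.2 hx) hcont fun g hg0 hg t ht => ?_
  have hanti : AntitoneOn (fun t => (g t).re) (Icc 0 T) := by
    refine antitoneOn_of_hasDerivWithinAt_nonpos (convex_Icc 0 T)
      (f' := fun t => (-2 / clampRe (-x) ((lam t : ℂ) - g t)).re)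
      (fun t ht => (hg t ht).re_comp.continuousWithinAt)
      (fun t ht => ((hg t (interior_subset ht)).re_comp.mono interior_subset)) fun t _ => ?_
    have := le_re_clampRe (-x) ((lam t : ℂ) - g t)
    rw [div_re]
    simp only [neg_re, neg_im, re_ofNat, im_ofNat, neg_zero, zero_mul, zero_div, add_zero]
    exact div_nonpos_of_nonpos_of_nonneg (by linarith) (normSq_nonneg _)
  have h1 : (g t).re ≤ x := by
    simpa [hg0] using hanti (left_mem_Icc.2 hT) ht ht.1
  have h2 := hlam t ht
  simp only [sub_re, ofReal_re]
  linarith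

/-- The Loewner flow started at a real point is real. -/
lemma Survives.exists_real {lam : ℝ → ℝ} {T : ℝ} (hT : 0 ≤ T) {x : ℝ}
    (h : Survives lam T (x : ℂ)) :
    ∃ u : ℝ → ℝ, u 0 = x ∧ ∀ t ∈ Icc (0:ℝ) T, u t ≠ lam t ∧
      HasDerivWithinAt u (2 / (u t - lam t)) (Icc 0 T) t := by
  obtain ⟨g, hg0, -, hg⟩ := h
  have hder : ∀ t ∈ Icc (0:ℝ) T, HasDerivWithinAt (fun t => (g t).im ^ 2)
      (2 * (g t).im * (2 / (g t - (lam t : ℂ))).im) (Icc 0 T) t := fun t ht => by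
    exact ((hg t ht).2.im_comp.pow 2).congr_deriv (by simp)
  have hanti : AntitoneOn (fun t => (g t).im ^ 2) (Icc 0 T) := by
    refine antitoneOn_of_hasDerivWithinAt_nonpos (convex_Icc 0 T)
      (f' := fun t => 2 * (g t).im * (2 / (g t - (lam t : ℂ))).im)
      (fun t ht => (hder t ht).continuousWithinAt)
      (fun t ht => (hder t (interior_subset ht)).mono interior_subset) fun t _ => ?_
    have e : 2 * (g t).im * (2 / (g t - (lam t : ℂ))).im
        = -(4 * (g t).im ^ 2 / normSq (g t - (lam t : ℂ))) := by
      rw [div_im]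
      simp only [re_ofNat, im_ofNat, zero_mul, zero_div, sub_im, ofReal_im, sub_zero, zero_sub]
      ring
    rw [e, neg_nonpos]
    exact div_nonneg (by positivity) (normSq_nonneg _)
  have him : ∀ t ∈ Icc (0:ℝ) T, (g t).im = 0 := fun t ht => by
    have := hanti (left_mem_Icc.2 hT) ht ht.1
    simp only [hg0, ofReal_im] at this
    exact pow_eq_zero_iff two_ne_zero |>.1 (le_antisymm (by simpa using this) (sq_nonneg _))
  refine ⟨fun t => (g t).re, by simp [hg0], fun t ht => ?_⟩
  have hreal : g t = ((g t).re : ℂ) := Complex.ext rfl (by simp [him t ht])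
  refine ⟨fun e => (hg t ht).1 (hreal.trans (congrArg _ e)), ?_⟩
  have := (hg t ht).2.re_comp
  rw [hreal, ← ofReal_sub, ← ofReal_ofNat, ← ofReal_div, ofReal_re] at this
  exact this

/-- If a real trajectory keeps distance at least `m / 2` to the left of the driving function, then
all points within `m / 10` of its starting point survive. -/
lemma survives_of_norm_sub_lt {lam u : ℝ → ℝ} {T m : ℝ} (hT : 0 ≤ T)
    (hcont : ContinuousOn lam (Icc 0 T))
    (hu : ∀ t ∈ Icc (0:ℝ) T, HasDerivWithinAt u (2 / (u t - lam t)) (Icc 0 T) t)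
    (hgap : ∀ t ∈ Icc (0:ℝ) T, m / 2 ≤ lam t - u t) {z : ℂ}
    (hz : ‖z - (u 0 : ℂ)‖ < m / 10) : Survives lam T z := by
  have hm : 0 < m := by linarith [norm_nonneg (z - (u 0 : ℂ))]
  refine survives_of_clamped (δ := m / 4) hT (by positivity) hcont fun g hg0 hg => ?_
  set F : ℝ → ℂ := fun t => -2 / clampRe (m / 4) ((lam t : ℂ) - g t) with hF
  have hder : ∀ t ∈ Icc (0:ℝ) T,
      HasDerivWithinAt (fun t => ((g t).re - u t) ^ 2 + (g t).im ^ 2)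
        (2 * ((g t).re - u t) * ((F t).re - 2 / (u t - lam t)) + 2 * (g t).im * (F t).im)
        (Icc 0 T) t := fun t ht => by
    exact ((((hg t ht).re_comp.sub (hu t ht)).pow 2).add ((hg t ht).im_comp.pow 2)).congr_deriv
      (by simp [hF])
  have hre : ∀ {t}, t ∈ Icc (0:ℝ) T → ((g t).re - u t) ^ 2 + (g t).im ^ 2 ≤ (m / 4) ^ 2 →
      m / 4 ≤ ((lam t : ℂ) - g t).re := fun {t} ht h => by
    have h1 : (g t).re - u t ≤ m / 4 :=
      (abs_le_of_sq_le_sq' (by nlinarith [sq_nonneg (g t).im]) (by positivity)).2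
    have h2 := hgap t ht
    simp only [sub_re, ofReal_re]
    linarith
  have hle : ∀ ⦃t⦄, t ∈ Icc (0:ℝ) T →
      ((g t).re - u t) ^ 2 + (g t).im ^ 2 ≤ (m / 4) ^ 2 := by
    refine image_le_of_deriv_right_lt_deriv_boundary'
      (fun t ht => (hder t ht).continuousWithinAt)
      (fun t ht => (hder t (Ico_subset_Icc_self ht)).Ici_of_Icc ht) ?_
      (B := fun _ => (m / 4) ^ 2) (B' := fun _ => 0) continuousOn_const
      (fun t _ => hasDerivWithinAt_const _ _ _) fun t ht heq => ?_
    · have h1 : ‖z - (u 0 : ℂ)‖ ^ 2 = ((g 0).re - u 0) ^ 2 + (g 0).im ^ 2 := by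
        rw [← normSq_eq_norm_sq, normSq_apply, hg0]
        simp only [sub_re, ofReal_re, sub_im, ofReal_im, sub_zero]
        ring
      rw [← h1]
      exact pow_le_pow_left₀ (norm_nonneg _) (by linarith) 2
    · replace ht := Ico_subset_Icc_self ht
      have hre' := hre ht heq.le
      have hq := hgap t ht
      have hFt : F t = -2 / ((lam t : ℂ) - g t) := by rw [hF]; simp only [clampRe_of_le hre']
      rw [hFt, div_re, div_im, normSq_apply]
      simp only [sub_re, ofReal_re] at hre'
      simp only [neg_re, neg_im, re_ofNat, im_ofNat, sub_re, sub_im, ofReal_re, ofReal_im,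
        zero_sub, neg_zero, zero_mul, zero_div, add_zero]
      obtain ⟨X, hX⟩ : ∃ X, X = (g t).re - u t := ⟨_, rfl⟩
      obtain ⟨q, hq'⟩ : ∃ q, q = lam t - u t := ⟨_, rfl⟩
      obtain ⟨Y, hY⟩ : ∃ Y, Y = (g t).im := ⟨_, rfl⟩
      have e1 : lam t - (g t).re = q - X := by rw [hX, hq']; ring
      have e2 : u t - lam t = -q := by rw [hq']; ring
      rw [e1] at hre'
      rw [e1, e2, ← hX, ← hY]
      rw [← hX, ← hY] at heq
      rw [← hq'] at hq
      have hq0 : 0 < q := by linarith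
      have hc : 0 < q - X := by linarith
      have hD : 0 < (q - X) * (q - X) + -Y * -Y := by nlinarith [mul_pos hc hc, sq_nonneg Y]
      have key : 2 * X * (-2 * (q - X) / ((q - X) * (q - X) + -Y * -Y) - 2 / -q)
          + 2 * Y * -(-2 * -Y / ((q - X) * (q - X) + -Y * -Y))
          = -(4 * (q - X) * (X ^ 2 + Y ^ 2) / (q * ((q - X) * (q - X) + -Y * -Y))) := by
        have := hD.ne'
        field_simp
        ring
      have hpos : 0 < 4 * (q - X) * (X ^ 2 + Y ^ 2) / (q * ((q - X) * (q - X) + -Y * -Y)) := by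
        rw [heq]
        positivity
      exact key.trans_lt (neg_lt_zero.2 hpos)
  exact fun t ht => hre ht (hle ht)

/-- A real trajectory to the left of a driving function dominating `4 * √(1 - t)` which survives
up to time `1` stays below `2 * √(1 - t)`. -/
lemma le_two_mul_sqrt {lam u : ℝ → ℝ}
    (hlow : ∀ t ∈ Ioo (0:ℝ) 1, 4 * √(1 - t) < lam t)
    (hu : ∀ t ∈ Icc (0:ℝ) 1, HasDerivWithinAt u (2 / (u t - lam t)) (Icc 0 1) t)
    (hu1 : u 1 < 0) {t : ℝ} (ht : t ∈ Icc (0:ℝ) 1) : u t ≤ 2 * √(1 - t) := by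
  by_contra! hlt
  have hsub : Icc t 1 ⊆ Icc (0:ℝ) 1 := Icc_subset_Icc_left ht.1
  have hle : ∀ ⦃τ⦄, τ ∈ Icc t 1 → 2 * √(1 - τ) ≤ u τ := by
    refine image_le_of_deriv_right_lt_deriv_boundary'
      (f' := fun τ => -1 / √(1 - τ)) (B' := fun τ => 2 / (u τ - lam τ)) (by fun_prop)
      (fun τ hτ => ?_) hlt.le
      (fun τ hτ => ((hu τ (hsub hτ)).mono hsub).continuousWithinAt)
      (fun τ hτ => (hu τ (hsub (Ico_subset_Icc_self hτ))).Ici_of_Icc ⟨ht.1.trans hτ.1, hτ.2⟩)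
      fun τ hτ heq => ?_
    · have h1 : (1 - τ) ≠ 0 := by linarith [hτ.2]
      have := (((hasDerivAt_id τ).const_sub 1).sqrt h1).const_mul 2
      refine (this.congr_deriv ?_).hasDerivWithinAt
      have : √(1 - τ) ≠ 0 := (Real.sqrt_pos.2 (by linarith [hτ.2])).ne'
      simp only [id]
      field_simp
    · have hne : t ≠ τ := by
        rintro rfl
        exact hlt.ne heq
      have hlam := hlow τ ⟨ht.1.trans_lt (lt_of_le_of_ne hτ.1 hne), hτ.2⟩
      have hpos : 0 < √(1 - τ) := Real.sqrt_pos.2 (by linarith [hτ.2])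
      rw [← heq, ← neg_sub (lam τ), div_neg, neg_div, neg_lt_neg_iff,
        div_lt_div_iff₀ (by linarith) hpos]
      linarith
  have := hle (right_mem_Icc.2 ht.2)
  simp only [sub_self, Real.sqrt_zero, mul_zero] at this
  linarith

/-- claim in the proof of Theorem 1.1: the leftmost real
point `p` of `K₁` stays at distance at least `(1/10)·min_{[0,s]} lam`
from the hull `K_s`. -/
theorem stmt15 (a r : ℝ) (ha : 4 ≤ a) (hr : r ∈ Ioo (0:ℝ) (1/2))
    (lam : ℝ → ℝ) (hcont : ContinuousOn lam (Icc 0 1)) (h1 : lam 1 = 0)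
    (hlow : ∀ t ∈ Icc (0:ℝ) 1, a * (1 - t) ^ r ≤ lam t)
    (s : ℝ) (hs : s ∈ Ioo (0:ℝ) 1) :
    (1 / 10) * sInf (lam '' Icc 0 s) ≤
      Metric.infDist ((sInf {x : ℝ | ((x : ℝ) : ℂ) ∈ LoewnerHull lam 1} : ℝ) : ℂ)
        (LoewnerHull lam s) := by
  have hlam0 : ∀ t ∈ Icc (0:ℝ) 1, 0 ≤ lam t := fun t ht =>
    (mul_nonneg (by linarith) (Real.rpow_nonneg (by linarith [ht.2]) r)).trans (hlow t ht)
  have hsqrt_le : ∀ t ∈ Icc (0:ℝ) 1, 4 * √(1 - t) ≤ lam t := fun t ht => by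
    have h0 : 0 ≤ 1 - t := by linarith [ht.2]
    rcases h0.eq_or_lt with h | h
    · rw [← h, Real.sqrt_zero, mul_zero]
      exact hlam0 t ht
    · refine le_trans ?_ (hlow t ht)
      rw [Real.sqrt_eq_rpow]
      have := Real.rpow_le_rpow_of_exponent_ge h (by linarith [ht.1]) hr.2.le
      gcongr
  have hsqrt_lt : ∀ t ∈ Ioo (0:ℝ) 1, 4 * √(1 - t) < lam t := fun t ht => by
    have h : 0 < 1 - t := by linarith [ht.2]
    refine lt_of_lt_of_le ?_ (hlow t (Ioo_subset_Icc_self ht))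
    rw [Real.sqrt_eq_rpow]
    have h2 := Real.rpow_lt_rpow_of_exponent_gt h (by linarith [ht.1]) hr.2
    have h3 : 0 < (1 - t) ^ r := Real.rpow_pos_of_pos h r
    nlinarith
  have hmem0 : ∀ T, 0 ≤ T → ((lam 0 : ℝ) : ℂ) ∈ LoewnerHull lam T := fun T hT =>
    ⟨by simp, fun ⟨g, hg0, _, hg⟩ => (hg 0 (left_mem_Icc.2 hT)).1 hg0⟩
  have hbdd : BddBelow {x : ℝ | ((x : ℝ) : ℂ) ∈ LoewnerHull lam 1} :=
    ⟨0, fun x hx => not_lt.1 fun hneg => hx.2 (survives_of_neg zero_le_one hcont hlam0 hneg)⟩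
  set p := sInf {x : ℝ | ((x : ℝ) : ℂ) ∈ LoewnerHull lam 1} with hp
  have hp0 : p ≤ lam 0 := csInf_le hbdd (hmem0 1 zero_le_one)
  have hsub : Icc (0:ℝ) s ⊆ Icc 0 1 := Icc_subset_Icc_right hs.2.le
  set m := sInf (lam '' Icc 0 s) with hm
  have hm_le : ∀ t ∈ Icc (0:ℝ) s, m ≤ lam t := fun t ht =>
    csInf_le ⟨0, by rintro _ ⟨τ, hτ, rfl⟩; exact hlam0 τ (hsub hτ)⟩ (mem_image_of_mem lam ht)
  have hdist : ∀ x < p, ∀ z ∈ LoewnerHull lam s, 1 / 10 * m ≤ ‖z - (x : ℂ)‖ := by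
    intro x hx z hz
    by_contra! hlt
    have hsurv : Survives lam 1 (x : ℂ) := by
      by_contra hns
      exact hx.not_ge (csInf_le hbdd ⟨by simp, hns⟩)
    obtain ⟨u, rfl, hu⟩ := hsurv.exists_real zero_le_one
    have hucont : ContinuousOn u (Icc 0 1) := fun t ht => (hu t ht).2.continuousWithinAt
    have hul : ∀ t ∈ Icc (0:ℝ) 1, u t < lam t := fun t ht => by
      by_contra! hge
      have hst : Icc 0 t ⊆ Icc (0:ℝ) 1 := Icc_subset_Icc_right ht.2
      obtain ⟨τ, hτ, he⟩ := intermediate_value_Icc ht.1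
        ((hucont.sub hcont).mono hst) (show (0:ℝ) ∈ Icc (u 0 - lam 0) (u t - lam t) from
          ⟨by linarith, by linarith⟩)
      exact (hu τ (hst hτ)).1 (sub_eq_zero.1 he)
    have hu1 : u 1 < 0 := h1 ▸ hul 1 (right_mem_Icc.2 zero_le_one)
    refine hz.2 (survives_of_norm_sub_lt (m := m) hs.1.le (hcont.mono hsub)
      (fun t ht => (hu t (hsub ht)).2.mono hsub) (fun t ht => ?_) (by linarith))
    have h2 := le_two_mul_sqrt hsqrt_lt (fun t ht => (hu t ht).2) hu1 (hsub ht)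
    have h3 := hsqrt_le t (hsub ht)
    have h4 := hm_le t ht
    linarith
  rw [Metric.le_infDist ⟨_, hmem0 s hs.1.le⟩]
  refine fun z hz => le_of_forall_pos_le_add fun ε hε => ?_
  refine (hdist (p - ε) (by linarith) z hz).trans ?_
  rw [dist_eq_norm, norm_sub_rev (p : ℂ)]
  calc ‖z - ((p - ε : ℝ) : ℂ)‖ = ‖(z - (p : ℂ)) + (ε : ℂ)‖ := by
        congr 1
        push_cast
        ring
    _ ≤ ‖z - (p : ℂ)‖ + ‖(ε : ℂ)‖ := norm_add_le _ _
    _ = ‖z - (p : ℂ)‖ + ε := by rw [norm_real, Real.norm_of_nonneg hε.le]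
end
end
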